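/- arXiv:0912.1842 — 3 statements merged into one kernel-verified Lean document; each statement's English description precedes it below -/
import Mathlib

section
/- For every p > 2 there is a constant C_p such that the following holds for all sufficiently large N. Set z = (log N)/3, M = ∏_{q ≤ z, q prime} q, and let N' be the least prime larger than ⌈2N/M⌉. Let b be an integer with gcd(b, M) = 1, let A₀ ⊆ ℤ/N'ℤ be (the reduction of) any subset of {n ∈ [1, N'] : b + nM is prime}, and let a = (log N/(N' log z))·1_{A₀} : ℤ/N'ℤ → ℝ. Then ∑_{m ∈ ℤ/N'ℤ} |â(m)|^p ≤ C_p, where C_p depends only on p (not on N, b, or A₀). -/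
/-- The Fourier transform on `ℤ/Nℤ`: `f̂(b) = ∑_{n} f(n) e(−nb/N)` with `e(x) = e^{2πix}`. -/
noncomputable def dft {N : ℕ} [NeZero N] (f : ZMod N → ℂ) (b : ZMod N) : ℂ :=
    ∑ n : ZMod N, f n * Complex.exp (-(2 * Real.pi * Complex.I * (n.val : ℂ) * (b.val : ℂ) / N))

section

open Finset

theorem sum_log_div_primes_le (n : ℕ) (hn : 1 ≤ n) :
    ∑ p ∈ Nat.primesLE n, Real.log p / p ≤ Real.log n + Real.log 4 := by
  have hn' : (0 : ℝ) < n := by exact_mod_cast hn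
  have hfac : ∑ p ∈ Nat.primesLE n, Real.log p * ((n / p : ℕ) : ℝ) ≤ n * Real.log n := by
    calc ∑ p ∈ Nat.primesLE n, Real.log p * ((n / p : ℕ) : ℝ)
        = ∑ p ∈ Nat.primesLE n, ∑ k ∈ Ioc 0 n with p ∣ k, Real.log p := by
          refine sum_congr rfl fun p _ => ?_
          rw [sum_const, Nat.Ioc_filter_dvd_card_eq_div, nsmul_eq_mul, mul_comm]
      _ = ∑ k ∈ Ioc 0 n, ∑ p ∈ Nat.primesLE n with p ∣ k, Real.log p := by
          simp only [sum_filter]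
          rw [sum_comm]
      _ ≤ ∑ k ∈ Ioc 0 n, Real.log n := by
          refine sum_le_sum fun k hk => ?_
          rw [mem_Ioc] at hk
          have hsub : {p ∈ Nat.primesLE n | p ∣ k} ⊆ k.primeFactors := by
            intro p hp
            simp only [mem_filter, Nat.mem_primesLE] at hp
            exact Nat.mem_primeFactors.2 ⟨hp.1.2, hp.2, by omega⟩
          have h1 : ∑ p ∈ Nat.primesLE n with p ∣ k, Real.log p
              ≤ ∑ p ∈ k.primeFactors, Real.log p :=
            sum_le_sum_of_subset_of_nonneg hsub fun _ _ _ => Real.log_natCast_nonneg _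
          refine h1.trans ?_
          rw [← Real.log_prod fun p hp => by
            exact_mod_cast (Nat.prime_of_mem_primeFactors hp).ne_zero, ← Nat.cast_prod]
          have h2 := Nat.le_of_dvd hk.1 (Nat.prod_primeFactors_dvd k)
          refine Real.log_le_log ?_ (by exact_mod_cast h2.trans hk.2)
          exact_mod_cast Finset.prod_pos fun p hp => (Nat.prime_of_mem_primeFactors hp).pos
      _ = n * Real.log n := by simp
  have htheta : ∑ p ∈ Nat.primesLE n, Real.log p ≤ Real.log 4 * n := by
    rw [← Chebyshev.theta_eq_sum_primesLE_log]
    exact Chebyshev.theta_le_log4_mul_x hn'.le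
  have hmul : n * ∑ p ∈ Nat.primesLE n, Real.log p / p
      ≤ ∑ p ∈ Nat.primesLE n, (Real.log p * ((n / p : ℕ) : ℝ) + Real.log p) := by
    rw [mul_sum]
    refine sum_le_sum fun p _ => ?_
    have h1 : (n : ℝ) / p ≤ ((n / p : ℕ) : ℝ) + 1 := by
      rw [← Nat.floor_div_eq_div (K := ℝ) n p]
      exact (Nat.lt_floor_add_one ((n : ℝ) / p)).le
    have := mul_le_mul_of_nonneg_left h1 (Real.log_natCast_nonneg p)
    calc (n : ℝ) * (Real.log p / p) = Real.log p * (n / p) := by ring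
      _ ≤ _ := by linarith
  rw [sum_add_distrib] at hmul
  refine le_of_mul_le_mul_left ?_ hn'
  linarith

theorem primesLE_succ_of_prime {n : ℕ} (h : (n + 1).Prime) :
    Nat.primesLE (n + 1) = insert (n + 1) (Nat.primesLE n) := by
  ext p
  simp only [Nat.mem_primesLE, mem_insert]
  constructor
  · rintro ⟨h1, h2⟩
    rcases Nat.lt_or_ge n p with h3 | h3
    · exact Or.inl (by omega)
    · exact Or.inr ⟨h3, h2⟩
  · rintro (rfl | ⟨h1, h2⟩)
    · exact ⟨le_rfl, h⟩
    · exact ⟨by omega, h2⟩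

theorem primesLE_succ_of_not_prime {n : ℕ} (h : ¬ (n + 1).Prime) :
    Nat.primesLE (n + 1) = Nat.primesLE n := by
  ext p
  simp only [Nat.mem_primesLE]
  constructor
  · rintro ⟨h1, h2⟩
    refine ⟨?_, h2⟩
    rcases Nat.lt_or_ge n p with h3 | h3
    · exact absurd (show (n + 1).Prime by rwa [show n + 1 = p by omega]) h
    · exact h3
  · rintro ⟨h1, h2⟩
    exact ⟨by omega, h2⟩

theorem sum_inv_primes_sub_le (n : ℕ) (hn : 2 ≤ n) :
    ∑ p ∈ Nat.primesLE n, (1 : ℝ) / p - (∑ p ∈ Nat.primesLE n, Real.log p / p) / Real.log n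
      ≤ Real.log (Real.log n) - Real.log (Real.log 2)
        + Real.log 4 * (1 / Real.log 2 - 1 / Real.log n) := by
  induction n, hn using Nat.le_induction with
  | base =>
    have h2 : Nat.primesLE 2 = {2} := by decide
    have : Real.log 2 ≠ 0 := (Real.log_pos one_lt_two).ne'
    rw [h2]
    simp only [sum_singleton, Nat.cast_ofNat]
    field_simp
    simp
  | succ n hn ih =>
    have hl : 0 < Real.log n := Real.log_pos (by exact_mod_cast hn)
    have hl' : 0 < Real.log ((n + 1 : ℕ) : ℝ) :=
      Real.log_pos (by exact_mod_cast (by omega : 1 < n + 1))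
    have hle : Real.log n ≤ Real.log ((n + 1 : ℕ) : ℝ) :=
      Real.log_le_log (by positivity) (by push_cast; linarith)
    have hstep : ∑ p ∈ Nat.primesLE (n + 1), (1 : ℝ) / p
          - (∑ p ∈ Nat.primesLE (n + 1), Real.log p / p) / Real.log ((n + 1 : ℕ) : ℝ)
        = ∑ p ∈ Nat.primesLE n, (1 : ℝ) / p
          - (∑ p ∈ Nat.primesLE n, Real.log p / p) / Real.log ((n + 1 : ℕ) : ℝ) := by
      by_cases h : (n + 1).Prime
      · have hnot : n + 1 ∉ Nat.primesLE n := by simp [Nat.mem_primesLE]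
        rw [primesLE_succ_of_prime h, sum_insert hnot, sum_insert hnot]
        have : ((n + 1 : ℕ) : ℝ) ≠ 0 := by positivity
        field_simp
        ring
      · rw [primesLE_succ_of_not_prime h]
    rw [hstep]
    have hA := sum_log_div_primes_le n (by omega)
    set A := ∑ p ∈ Nat.primesLE n, Real.log p / p
    set l := Real.log n
    set l' := Real.log ((n + 1 : ℕ) : ℝ)
    have hd : 0 ≤ 1 / l - 1 / l' := sub_nonneg.2 (one_div_le_one_div_of_le hl hle)
    have h1 : A * (1 / l - 1 / l') ≤ (l + Real.log 4) * (1 / l - 1 / l') :=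
      mul_le_mul_of_nonneg_right hA hd
    have h2 : l * (1 / l - 1 / l') ≤ Real.log l' - Real.log l := by
      have := Real.one_sub_inv_le_log_of_pos (show 0 < l' / l by positivity)
      rw [Real.log_div hl'.ne' hl.ne'] at this
      refine le_trans (le_of_eq ?_) this
      field_simp
    have h3 : A / l' = A / l - A * (1 / l - 1 / l') := by ring
    rw [h3]
    linarith

theorem exists_sum_inv_primes_le : ∃ C : ℝ, ∀ n : ℕ, 2 ≤ n →
    ∑ p ∈ Nat.primesLE n, (1 : ℝ) / p ≤ Real.log (Real.log n) + C := by
  refine ⟨1 - Real.log (Real.log 2) + Real.log 4 / Real.log 2, fun n hn => ?_⟩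
  have hl : 0 < Real.log n := Real.log_pos (by exact_mod_cast hn)
  have h1 := sum_inv_primes_sub_le n hn
  have h2 := div_le_div_of_nonneg_right (sum_log_div_primes_le n (by omega)) hl.le
  rw [add_div, div_self hl.ne'] at h2
  have h3 : Real.log 4 * (1 / Real.log 2 - 1 / Real.log n)
    = Real.log 4 / Real.log 2 - Real.log 4 / Real.log n := by ring
  linarith

theorem sum_inv_mul_pred_le (n : ℕ) :
    ∑ k ∈ Ioc 1 n, (1 : ℝ) / (k * (k - 1)) ≤ 1 := by
  rcases Nat.lt_or_ge n 1 with h | h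
  · obtain rfl : n = 0 := by omega
    simp
  · suffices ∑ k ∈ Ioc 1 n, (1 : ℝ) / (k * (k - 1)) = 1 - 1 / n by
      rw [this]; simp
    induction n, h using Nat.le_induction with
    | base => simp
    | succ n hn ih =>
      rw [sum_Ioc_succ_top hn, ih]
      have : (n : ℝ) ≠ 0 := by positivity
      push_cast
      rw [add_sub_cancel_right]
      field_simp
      ring

theorem exists_prod_primes_le : ∃ C : ℝ, 0 < C ∧ ∀ n : ℕ, 2 ≤ n →
    ∏ p ∈ Nat.primesLE n, (1 + 1 / ((p : ℝ) - 1)) ≤ C * Real.log n := by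
  obtain ⟨C, hC⟩ := exists_sum_inv_primes_le
  refine ⟨Real.exp (C + 1), Real.exp_pos _, fun n hn => ?_⟩
  have hl : 0 < Real.log n := Real.log_pos (by exact_mod_cast hn)
  calc ∏ p ∈ Nat.primesLE n, (1 + 1 / ((p : ℝ) - 1))
      ≤ ∏ p ∈ Nat.primesLE n, Real.exp (1 / p + 1 / (p * ((p : ℝ) - 1))) := by
        refine prod_le_prod (fun p hp => ?_) fun p hp => ?_
        all_goals
          have h2 : (2 : ℝ) ≤ p := by exact_mod_cast (Nat.mem_primesLE.1 hp).2.two_le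
          have h1 : (0 : ℝ) < p - 1 := by linarith
        · positivity
        · have : (1 : ℝ) / p + 1 / (p * ((p : ℝ) - 1)) = 1 / ((p : ℝ) - 1) := by
            field_simp
            ring
          rw [this, add_comm]
          exact Real.add_one_le_exp _
    _ = Real.exp (∑ p ∈ Nat.primesLE n, (1 : ℝ) / p
          + ∑ p ∈ Nat.primesLE n, (1 : ℝ) / (p * ((p : ℝ) - 1))) := by
        rw [← Real.exp_sum, sum_add_distrib]
    _ ≤ Real.exp ((Real.log (Real.log n) + C) + 1) := by
        refine Real.exp_le_exp.2 (add_le_add (hC n hn) ?_)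
        refine le_trans (sum_le_sum_of_subset_of_nonneg (t := Ioc 1 n) ?_ ?_)
          (sum_inv_mul_pred_le n)
        · intro p hp
          rw [Nat.mem_primesLE] at hp
          exact mem_Ioc.2 ⟨hp.2.one_lt, hp.1⟩
        · intro k hk _
          have : (1 : ℝ) < k := by exact_mod_cast (mem_Ioc.1 hk).1
          have : (0 : ℝ) < k - 1 := by linarith
          positivity
    _ = Real.exp (C + 1) * Real.log n := by
        rw [add_assoc, Real.exp_add, Real.exp_log hl, mul_comm]

open Classical in
/-- The squarefree integers in `[1, R]` all of whose prime factors exceed `w`. -/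
noncomputable def roughSquarefree (w R : ℕ) : Finset ℕ :=
  {q ∈ Icc 1 R | Squarefree q ∧ ∀ l, l.Prime → l ∣ q → w < l}

theorem mem_roughSquarefree {w R q : ℕ} : q ∈ roughSquarefree w R ↔
    (1 ≤ q ∧ q ≤ R) ∧ Squarefree q ∧ ∀ l, l.Prime → l ∣ q → w < l := by
  simp [roughSquarefree]

/-- The singular sum `∑ 1/φ(q)` normalising Selberg's sieve. -/
noncomputable def selbergSum (w R : ℕ) : ℝ := ∑ q ∈ roughSquarefree w R, (1 : ℝ) / q.totient

theorem sum_dvd_le (w R l : ℕ) (hl : l.Prime) :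
    ∑ q ∈ roughSquarefree w R with l ∣ q, (1 : ℝ) / q.totient
      ≤ 1 / ((l : ℝ) - 1) * ∑ q ∈ roughSquarefree w R with ¬ l ∣ q, (1 : ℝ) / q.totient := by
  have hl1 : (1 : ℝ) < l := by exact_mod_cast hl.one_lt
  have hcop : ∀ q ∈ {q ∈ roughSquarefree w R | l ∣ q}, l.Coprime (q / l) := by
    intro q hq
    simp only [mem_filter, mem_roughSquarefree] at hq
    exact Nat.coprime_of_squarefree_mul (by rw [Nat.mul_div_cancel' hq.2]; exact hq.1.2.1)
  have hmaps : ∀ q ∈ {q ∈ roughSquarefree w R | l ∣ q},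
      q / l ∈ {q ∈ roughSquarefree w R | ¬ l ∣ q} := by
    intro q hq
    have hc := hcop q hq
    simp only [mem_filter, mem_roughSquarefree] at hq ⊢
    have hd : q / l ∣ q := Nat.div_dvd_of_dvd hq.2
    refine ⟨⟨⟨Nat.pos_of_dvd_of_pos hd hq.1.1.1, (Nat.le_of_dvd hq.1.1.1 hd).trans hq.1.1.2⟩,
      hq.1.2.1.squarefree_of_dvd hd, fun k hk hkd => hq.1.2.2 k hk (hkd.trans hd)⟩, ?_⟩
    exact (Nat.Prime.coprime_iff_not_dvd hl).1 hc
  have hinj : Set.InjOn (fun q => q / l) ({q ∈ roughSquarefree w R | l ∣ q} : Finset ℕ) := by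
    intro q hq q' hq' h
    simp only [coe_filter, Set.mem_ofPred_eq] at hq hq' h
    rw [← Nat.mul_div_cancel' hq.2, ← Nat.mul_div_cancel' hq'.2, h]
  calc ∑ q ∈ roughSquarefree w R with l ∣ q, (1 : ℝ) / q.totient
      = ∑ q ∈ roughSquarefree w R with l ∣ q,
          1 / ((l : ℝ) - 1) * (1 / ((q / l).totient : ℝ)) := by
        refine sum_congr rfl fun q hq => ?_
        have hc := hcop q hq
        conv_lhs => rw [← Nat.mul_div_cancel' (mem_filter.1 hq).2, Nat.totient_mul hc,
          Nat.totient_prime hl]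
        rw [Nat.cast_mul, Nat.cast_sub hl.one_le, Nat.cast_one, div_mul_div_comm, one_mul]
    _ = 1 / ((l : ℝ) - 1) *
          ∑ q ∈ image (fun q => q / l) {q ∈ roughSquarefree w R | l ∣ q},
            (1 : ℝ) / q.totient := by
        rw [← mul_sum, sum_image hinj]
    _ ≤ _ := by
        refine mul_le_mul_of_nonneg_left ?_ (by have := sub_pos.2 hl1; positivity)
        refine sum_le_sum_of_subset_of_nonneg (image_subset_iff.2 hmaps) ?_
        intros; positivity

theorem selbergSum_le_succ (w R : ℕ) (hw : (w + 1).Prime) :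
    selbergSum w R ≤ (1 + 1 / (((w + 1 : ℕ) : ℝ) - 1)) * selbergSum (w + 1) R := by
  have hsplit : {q ∈ roughSquarefree w R | ¬ (w + 1) ∣ q} = roughSquarefree (w + 1) R := by
    ext q
    simp only [mem_filter, mem_roughSquarefree]
    constructor
    · rintro ⟨⟨h1, h2, h3⟩, h4⟩
      refine ⟨h1, h2, fun l hl hd => ?_⟩
      rcases Nat.lt_or_ge (w + 1) l with h | h
      · exact h
      · have := h3 l hl hd
        obtain rfl : l = w + 1 := by omega
        exact absurd hd h4
    · rintro ⟨h1, h2, h3⟩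
      exact ⟨⟨h1, h2, fun l hl hd => by have := h3 l hl hd; omega⟩,
        fun hd => absurd (h3 _ hw hd) (lt_irrefl _)⟩
  have h := sum_dvd_le w R (w + 1) hw
  rw [hsplit] at h
  have h2 := sum_filter_add_sum_filter_not (roughSquarefree w R) (fun q => (w + 1) ∣ q)
    (fun q => (1 : ℝ) / q.totient)
  rw [hsplit] at h2
  unfold selbergSum
  rw [← h2, add_mul, one_mul]
  linarith

theorem selbergSum_zero_le (w R : ℕ) :
    selbergSum 0 R ≤ (∏ p ∈ Nat.primesLE w, (1 + 1 / ((p : ℝ) - 1))) * selbergSum w R := by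
  induction w with
  | zero => simp [show Nat.primesLE 0 = ∅ by decide]
  | succ w ih =>
    have hnn : ∀ p ∈ Nat.primesLE w, 0 ≤ 1 + 1 / ((p : ℝ) - 1) := fun p hp => by
      have : (1 : ℝ) < p := by exact_mod_cast (Nat.mem_primesLE.1 hp).2.one_lt
      have := sub_pos.2 this
      positivity
    by_cases h : (w + 1).Prime
    · have hnot : w + 1 ∉ Nat.primesLE w := by simp [Nat.mem_primesLE]
      rw [primesLE_succ_of_prime h, prod_insert hnot]
      refine ih.trans ?_
      have := mul_le_mul_of_nonneg_left (selbergSum_le_succ w R h) (prod_nonneg hnn)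
      linarith
    · rw [primesLE_succ_of_not_prime h]
      refine ih.trans (le_of_eq ?_)
      congr 1
      unfold selbergSum
      congr 1
      ext q
      simp only [mem_roughSquarefree]
      refine and_congr_right fun _ => and_congr_right fun _ => forall_congr' fun l => ?_
      refine forall_congr' fun hl => forall_congr' fun _ => ?_
      have : l ≠ w + 1 := by rintro rfl; exact h hl
      omega

theorem log_le_two_mul_selbergSum_zero (R : ℕ) (hR : 1 ≤ R) :
    Real.log R ≤ 2 * selbergSum 0 R := by
  have hexists : ∀ n : ℕ, ∃ x : ℕ × ℕ, x.2 ^ 2 * x.1 = n ∧ Squarefree x.1 := fun n => by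
    obtain ⟨a, c, h, h'⟩ := Nat.sq_mul_squarefree n
    exact ⟨(a, c), h, h'⟩
  choose g hg hgs using hexists
  have hsq : ∑ d ∈ Icc 1 R, (1 : ℝ) / d ^ 2 ≤ 2 := by
    have h1 := sum_inv_mul_pred_le R
    rw [← Finset.sum_erase_add (Icc 1 R) _ (mem_Icc.2 ⟨le_rfl, hR⟩)]
    have h2 : (Icc 1 R).erase 1 = Ioc 1 R := Icc_erase_left 1 R
    have h3 : ∑ d ∈ Ioc 1 R, (1 : ℝ) / d ^ 2 ≤ ∑ k ∈ Ioc 1 R, (1 : ℝ) / (k * (k - 1)) := by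
      refine sum_le_sum fun d hd => ?_
      have : (1 : ℝ) < d := by exact_mod_cast (mem_Ioc.1 hd).1
      have := sub_pos.2 this
      exact one_div_le_one_div_of_le (by positivity) (by nlinarith)
    rw [h2]
    norm_num at h3 h1 ⊢
    linarith
  have hinj : Set.InjOn g (Icc 1 R : Finset ℕ) := by
    intro n _ n' _ h
    rw [← hg n, ← hg n', h]
  have hmaps : ∀ n ∈ Icc 1 R, g n ∈ roughSquarefree 0 R ×ˢ Icc 1 R := by
    intro n hn
    rw [mem_Icc] at hn
    have h0 : (g n).1 ≠ 0 := (hgs n).ne_zero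
    have h1 : (g n).2 ≠ 0 := by
      intro h
      have := hg n
      rw [h] at this
      simp at this
      omega
    have hd1 : (g n).1 ∣ n := Dvd.intro_left _ (hg n)
    have hd2 : (g n).2 ∣ n := (dvd_pow_self _ two_ne_zero).trans (Dvd.intro _ (hg n))
    rw [mem_product, mem_roughSquarefree, mem_Icc]
    exact ⟨⟨⟨by omega, (Nat.le_of_dvd hn.1 hd1).trans hn.2⟩, hgs n, fun l hl _ => hl.pos⟩,
      by omega, (Nat.le_of_dvd hn.1 hd2).trans hn.2⟩
  have hharm : Real.log R ≤ ∑ n ∈ Icc 1 R, (1 : ℝ) / n := by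
    have h1 : Real.log R ≤ Real.log (R + 1) :=
      Real.log_le_log (by exact_mod_cast hR) (by linarith)
    have h2 := log_add_one_le_harmonic R
    rw [harmonic_eq_sum_Icc] at h2
    push_cast at h2
    simp only [one_div]
    linarith
  calc Real.log R ≤ ∑ n ∈ Icc 1 R, (1 : ℝ) / n := hharm
    _ = ∑ n ∈ Icc 1 R, (1 : ℝ) / (g n).1 * (1 / (g n).2 ^ 2) := by
        refine sum_congr rfl fun n _ => ?_
        conv_lhs => rw [← hg n]
        push_cast
        rw [div_mul_div_comm, one_mul, mul_comm]
    _ = ∑ x ∈ image g (Icc 1 R), (1 : ℝ) / x.1 * (1 / x.2 ^ 2) := by rw [sum_image hinj]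
    _ ≤ ∑ x ∈ roughSquarefree 0 R ×ˢ Icc 1 R, (1 : ℝ) / x.1 * (1 / x.2 ^ 2) := by
        refine sum_le_sum_of_subset_of_nonneg (image_subset_iff.2 hmaps) ?_
        intros; positivity
    _ = (∑ q ∈ roughSquarefree 0 R, (1 : ℝ) / q) * ∑ d ∈ Icc 1 R, (1 : ℝ) / d ^ 2 := by
        rw [sum_product, sum_mul_sum]
    _ ≤ selbergSum 0 R * 2 := by
        refine mul_le_mul (sum_le_sum fun q hq => ?_) hsq
          (sum_nonneg fun _ _ => by positivity)
          (sum_nonneg fun _ _ => by positivity)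
        rw [mem_roughSquarefree] at hq
        exact one_div_le_one_div_of_le (by exact_mod_cast Nat.totient_pos.2 hq.1.1)
          (by exact_mod_cast Nat.totient_le q)
    _ = _ := mul_comm _ _

theorem exists_log_le_selbergSum : ∃ C : ℝ, 0 < C ∧ ∀ w R : ℕ, 2 ≤ w → 1 ≤ R →
    Real.log R ≤ C * Real.log w * selbergSum w R := by
  obtain ⟨C, hC, h⟩ := exists_prod_primes_le
  refine ⟨2 * C, by positivity, fun w R hw hR => ?_⟩
  have h1 := log_le_two_mul_selbergSum_zero R hR
  have h2 := selbergSum_zero_le w R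
  have h3 : 0 ≤ selbergSum w R := sum_nonneg fun _ _ => by positivity
  have h4 := mul_le_mul_of_nonneg_right (h w hw) h3
  linarith

/-- The additive character `e(t) = exp(2πit)` of `ℝ`. -/
noncomputable def expi (t : ℝ) : ℂ := Complex.exp (2 * Real.pi * Complex.I * t)

theorem expi_add (s t : ℝ) : expi (s + t) = expi s * expi t := by
  simp only [expi, ← Complex.exp_add]
  push_cast
  ring_nf

theorem norm_expi (t : ℝ) : ‖expi t‖ = 1 := by
  rw [expi, show 2 * (Real.pi : ℂ) * Complex.I * t = ((2 * Real.pi * t : ℝ) : ℂ) * Complex.I by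
    push_cast; ring]
  exact Complex.norm_exp_ofReal_mul_I _

theorem conj_expi (t : ℝ) : (starRingEnd ℂ) (expi t) = expi (-t) := by
  rw [expi, expi, ← Complex.exp_conj]
  simp [Complex.conj_ofNat]

theorem expi_nat_mul (n : ℕ) (t : ℝ) : expi (n * t) = expi t ^ n := by
  rw [expi, expi, ← Complex.exp_nat_mul]
  push_cast
  ring_nf

theorem expi_intCast (k : ℤ) : expi k = 1 := by
  rw [expi, Complex.exp_eq_one_iff]
  exact ⟨k, by push_cast; ring⟩

theorem expi_eq_one_iff (t : ℝ) : expi t = 1 ↔ ∃ k : ℤ, t = k := by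
  constructor
  · intro h
    obtain ⟨k, hk⟩ := Complex.exp_eq_one_iff.1 h
    refine ⟨k, ?_⟩
    have h2 : 2 * (Real.pi : ℂ) * Complex.I ≠ 0 := Complex.two_pi_I_ne_zero
    have : (t : ℂ) = k := mul_left_cancel₀ h2 (by rw [hk]; ring)
    exact_mod_cast this
  · rintro ⟨k, rfl⟩
    exact expi_intCast k

theorem norm_pow_sub_one_le (ζ : ℂ) (hζ : ‖ζ‖ = 1) (j : ℕ) : ‖ζ ^ j - 1‖ ≤ j * ‖ζ - 1‖ := by
  rw [← geom_sum_mul, norm_mul]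
  refine mul_le_mul_of_nonneg_right ?_ (norm_nonneg _)
  refine (norm_sum_le _ _).trans ?_
  simp [hζ]

/-- An `n`-th root of unity different from `1` is at distance at least `1/n` from `1`. -/
theorem one_le_mul_norm_sub_one (n : ℕ) (hn : 0 < n) (ζ : ℂ) (hζ : ζ ^ n = 1)
    (h1 : ζ ≠ 1) : 1 ≤ n * ‖ζ - 1‖ := by
  have hnorm : ‖ζ‖ = 1 := Complex.norm_eq_one_of_pow_eq_one hζ hn.ne'
  have hsum : ∑ j ∈ range n, ζ ^ j = 0 := by
    have := geom_sum_mul ζ n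
    rw [hζ, sub_self] at this
    exact (mul_eq_zero.1 this).resolve_right (sub_ne_zero.2 h1)
  have h2 : (n : ℂ) = - ∑ j ∈ range n, (ζ ^ j - 1) := by
    rw [sum_sub_distrib, hsum]; simp
  have h3 : (n : ℝ) ≤ n * (n * ‖ζ - 1‖) := by
    calc (n : ℝ) = ‖(n : ℂ)‖ := by simp
      _ ≤ ∑ j ∈ range n, ‖ζ ^ j - 1‖ := by rw [h2, norm_neg]; exact norm_sum_le _ _
      _ ≤ ∑ j ∈ range n, n * ‖ζ - 1‖ := by
          refine sum_le_sum fun j hj => (norm_pow_sub_one_le ζ hnorm j).trans ?_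
          have : (j : ℝ) ≤ n := by exact_mod_cast (mem_range.1 hj).le
          exact mul_le_mul_of_nonneg_right this (norm_nonneg _)
      _ = _ := by simp
  have hn' : (0 : ℝ) < n := by exact_mod_cast hn
  exact le_of_mul_le_mul_left (by linarith) hn'

theorem den_eq_one_of_norm_expi_sub_one_lt (r : ℚ) (h : r.den * ‖expi r - 1‖ < 1) :
    r.den = 1 := by
  have hpow : expi r ^ r.den = 1 := by
    rw [← expi_nat_mul]
    have : ((r.den : ℝ) * (r : ℝ)) = ((r.num : ℤ) : ℝ) := by exact_mod_cast Rat.den_mul_eq_num r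
    rw [this, expi_intCast]
  have h1 : expi r = 1 := by
    by_contra h1
    exact absurd (one_le_mul_norm_sub_one _ r.den_pos _ hpow h1) (not_le.2 h)
  obtain ⟨k, hk⟩ := (expi_eq_one_iff _).1 h1
  have : r = k := by exact_mod_cast hk
  rw [this]; rfl

theorem sum_nthRootsFinset_one (n : ℕ) (hn : 1 < n) :
    ∑ ξ ∈ Polynomial.nthRootsFinset n (1 : ℂ), ξ = 0 := by
  have hζ := Complex.isPrimitiveRoot_exp n (by omega)
  set ζ := Complex.exp (2 * Real.pi * Complex.I / n)
  have himg : Polynomial.nthRootsFinset n (1 : ℂ) = image (fun i => ζ ^ i) (range n) := by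
    symm
    apply eq_of_subset_of_card_le
    · intro x hx
      obtain ⟨i, _, rfl⟩ := mem_image.1 hx
      rw [Polynomial.mem_nthRootsFinset (by omega), ← pow_mul, mul_comm, pow_mul, hζ.pow_eq_one,
        one_pow]
    · rw [hζ.card_nthRootsFinset, card_image_of_injOn, card_range]
      intro i hi j hj h
      simp only [coe_range, Set.mem_Iio] at hi hj
      exact hζ.pow_inj hi hj h
  rw [himg, sum_image]
  · exact hζ.geom_sum_eq_zero hn
  · intro i hi j hj h
    simp only [coe_range, Set.mem_Iio] at hi hj
    exact hζ.pow_inj hi hj h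

theorem sum_primitiveRoots (n : ℕ) (hn : 0 < n) :
    ∑ ξ ∈ primitiveRoots n ℂ, ξ = ArithmeticFunction.moebius n := by
  classical
  have h := (ArithmeticFunction.sum_eq_iff_sum_mul_moebius_eq (R := ℂ)
    (f := fun n => ∑ ξ ∈ primitiveRoots n ℂ, ξ) (g := fun n => if n = 1 then 1 else 0)).1 ?_ n hn
  · rw [← h, Nat.sum_divisorsAntidiagonal
      (f := fun i j => (ArithmeticFunction.moebius i : ℂ) * if j = 1 then 1 else 0)]
    rw [sum_eq_single n]
    · simp [Nat.div_self hn]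
    · intro d hd hdn
      rw [if_neg, mul_zero]
      intro h
      exact hdn (Nat.eq_of_dvd_of_div_eq_one (Nat.dvd_of_mem_divisors hd) h)
    · intro h
      simp [hn.ne'] at h
  · intro n hn
    rw [← sum_biUnion]
    · rw [← IsPrimitiveRoot.nthRoots_one_eq_biUnion_primitiveRoots]
      split_ifs with h
      · subst h
        simp only [Polynomial.nthRootsFinset_def, Polynomial.nthRoots, pow_one,
          Polynomial.roots_X_sub_C]
        simp
      · exact sum_nthRootsFinset_one n (by omega)
    · intro i _ j _ hij
      exact IsPrimitiveRoot.disjoint hij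

/-- Ramanujan's sum at an argument coprime to the modulus. -/
theorem sum_coprime_expi (q : ℕ) (hq : 0 < q) (k : ℤ) (hk : IsCoprime k (q : ℤ)) :
    ∑ a ∈ range q with q.Coprime a, expi (((a : ℚ) / q : ℚ) * k)
      = ArithmeticFunction.moebius q := by
  have hζ0 := Complex.isPrimitiveRoot_exp q hq.ne'
  have hζ := hζ0.zpow_of_gcd_eq_one k (Int.isCoprime_iff_gcd_eq_one.1 hk)
  have : NeZero q := ⟨hq.ne'⟩
  have hpow : ∀ a : ℕ, expi (((a : ℚ) / q : ℚ) * k)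
      = (Complex.exp (2 * Real.pi * Complex.I / q) ^ k) ^ a := by
    intro a
    rw [← Complex.exp_int_mul, ← Complex.exp_nat_mul, expi]
    push_cast
    ring_nf
  rw [← sum_primitiveRoots q hq]
  refine sum_bij (fun a _ => expi (((a : ℚ) / q : ℚ) * k)) ?_ ?_ ?_ ?_
  · intro a ha
    rw [mem_filter] at ha
    rw [mem_primitiveRoots hq, hpow]
    exact hζ.pow_of_coprime a ha.2.symm
  · intro a ha a' ha' h
    rw [mem_filter, mem_range] at ha ha'
    simp only [hpow] at h
    exact hζ.pow_inj ha.1 ha'.1 h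
  · intro ξ hξ
    rw [mem_primitiveRoots hq, hζ.isPrimitiveRoot_iff] at hξ
    obtain ⟨i, hi, hc, h⟩ := hξ
    exact ⟨i, mem_filter.2 ⟨mem_range.2 hi, hc.symm⟩, by rw [hpow, h]⟩
  · intro a _; rfl

/-- The fractions in `[0, 1)` whose denominator in lowest terms lies in `roughSquarefree w R`. -/
noncomputable def fareyPoints (w R : ℕ) : Finset ℚ :=
  (roughSquarefree w R).biUnion fun q =>
    ({a ∈ range q | q.Coprime a}).image fun a : ℕ => (a : ℚ) / q

theorem den_natCast_div {q a : ℕ} (hq : 0 < q) (h : q.Coprime a) : ((a : ℚ) / q).den = q := by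
  have := Rat.den_div_eq_of_coprime (a := (a : ℤ)) (b := (q : ℤ)) (by exact_mod_cast hq)
    (by simpa using h.symm)
  rw [Int.cast_natCast, Int.cast_natCast] at this
  exact Int.ofNat_inj.1 this

theorem mem_fareyPoints {w R : ℕ} {x : ℚ} (hx : x ∈ fareyPoints w R) :
    0 ≤ x ∧ x < 1 ∧ x.den ∈ roughSquarefree w R := by
  simp only [fareyPoints, mem_biUnion, mem_image, mem_filter, mem_range] at hx
  obtain ⟨q, hq, a, ⟨ha, hc⟩, rfl⟩ := hx
  have hq0 : 0 < q := by omega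
  refine ⟨by positivity, ?_, by rwa [den_natCast_div hq0 hc]⟩
  rw [div_lt_one (by exact_mod_cast hq0)]
  exact_mod_cast ha

theorem sum_fareyPoints {E : Type*} [AddCommMonoid E] (w R : ℕ) (f : ℚ → E) :
    ∑ x ∈ fareyPoints w R, f x
      = ∑ q ∈ roughSquarefree w R, ∑ a ∈ range q with q.Coprime a, f ((a : ℚ) / q) := by
  rw [fareyPoints, sum_biUnion]
  · refine sum_congr rfl fun q hq => ?_
    have hq0 : (q : ℚ) ≠ 0 := by
      have := (mem_roughSquarefree.1 hq).1.1
      positivity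
    rw [sum_image]
    intro a _ a' _ h
    have : (a : ℚ) / q = a' / q := h
    rw [div_left_inj' hq0] at this
    exact_mod_cast this
  · intro q hq q' hq' hne
    rw [Function.onFun, disjoint_left]
    intro x hx hx'
    simp only [mem_image, mem_filter] at hx hx'
    obtain ⟨a, ha, rfl⟩ := hx
    obtain ⟨a', ha', h⟩ := hx'
    have h1 := (mem_roughSquarefree.1 hq).1.1
    have h2 := (mem_roughSquarefree.1 hq').1.1
    apply hne
    rw [← den_natCast_div h1 ha.2, ← den_natCast_div h2 ha'.2, h]

theorem sum_fareyPoints_den (w R : ℕ) (f : ℕ → ℝ) :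
    ∑ x ∈ fareyPoints w R, f x.den = ∑ q ∈ roughSquarefree w R, q.totient * f q := by
  rw [sum_fareyPoints]
  refine sum_congr rfl fun q hq => ?_
  rw [sum_congr rfl fun a ha => by
    rw [den_natCast_div (mem_roughSquarefree.1 hq).1.1 (mem_filter.1 ha).2]]
  rw [sum_const, nsmul_eq_mul, Nat.totient_eq_card_coprime]

theorem card_fareyPoints_le (w R : ℕ) : ((fareyPoints w R).card : ℝ) ≤ R ^ 2 := by
  have h := sum_fareyPoints_den w R (fun _ => 1)
  simp only [sum_const, nsmul_eq_mul, mul_one] at h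
  rw [h]
  calc ∑ q ∈ roughSquarefree w R, (q.totient : ℝ) ≤ ∑ q ∈ roughSquarefree w R, (R : ℝ) := by
        refine sum_le_sum fun q hq => ?_
        exact_mod_cast (Nat.totient_le q).trans (mem_roughSquarefree.1 hq).1.2
    _ ≤ ∑ q ∈ Icc 1 R, (R : ℝ) := by
        refine sum_le_sum_of_subset_of_nonneg ?_ fun _ _ _ => by positivity
        intro q hq
        exact mem_Icc.2 (mem_roughSquarefree.1 hq).1
    _ = R ^ 2 := by simp [sq]

theorem sum_fareyPoints_totient_sq (w R : ℕ) :
    ∑ x ∈ fareyPoints w R, (1 / (x.den.totient : ℝ)) ^ 2 = selbergSum w R := by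
  rw [sum_fareyPoints_den w R (fun q => (1 / (q.totient : ℝ)) ^ 2), selbergSum]
  refine sum_congr rfl fun q hq => ?_
  have : (q.totient : ℝ) ≠ 0 := by
    exact_mod_cast (Nat.totient_pos.2 (mem_roughSquarefree.1 hq).1.1).ne'
  field_simp

theorem sum_fareyPoints_dvd_totient_sq_le (w R l : ℕ) (hl : l.Prime) (hlw : w < l) (hw : 1 ≤ w) :
    ∑ x ∈ fareyPoints w R with l ∣ x.den, (1 / (x.den.totient : ℝ)) ^ 2
      ≤ selbergSum w R / w := by
  rw [sum_filter, sum_fareyPoints_den w R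
    (fun q => if l ∣ q then (1 / (q.totient : ℝ)) ^ 2 else 0)]
  have h1 : ∑ q ∈ roughSquarefree w R,
        (q.totient : ℝ) * (if l ∣ q then (1 / (q.totient : ℝ)) ^ 2 else 0)
      = ∑ q ∈ roughSquarefree w R with l ∣ q, (1 : ℝ) / q.totient := by
    rw [sum_filter]
    refine sum_congr rfl fun q hq => ?_
    have : (q.totient : ℝ) ≠ 0 := by
      exact_mod_cast (Nat.totient_pos.2 (mem_roughSquarefree.1 hq).1.1).ne'
    split_ifs
    · field_simp
    · simp
  rw [h1]
  refine (sum_dvd_le w R l hl).trans ?_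
  have hw' : (0 : ℝ) < w := by exact_mod_cast hw
  have hl' : (w : ℝ) ≤ l - 1 := by
    have : ((w + 1 : ℕ) : ℝ) ≤ l := by exact_mod_cast hlw
    push_cast at this
    linarith
  rw [div_eq_mul_one_div (selbergSum w R), mul_comm (selbergSum w R)]
  refine mul_le_mul (one_div_le_one_div_of_le hw' hl') ?_
    (sum_nonneg fun _ _ => by positivity) (by positivity)
  exact sum_le_sum_of_subset_of_nonneg (filter_subset _ _) fun _ _ _ => by positivity

theorem coprime_of_mem_roughSquarefree {w R M q : ℕ} (hM : ∀ l, l.Prime → l ∣ M → l ≤ w)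
    (hq : q ∈ roughSquarefree w R) : M.Coprime q := by
  refine Nat.Coprime.symm (Nat.coprime_of_dvd fun l hl h1 h2 => ?_)
  exact absurd ((mem_roughSquarefree.1 hq).2.2 l hl h1) (not_lt.2 (hM l hl h2))

/-- Two differences `x - y`, `x' - y'` of fractions whose `M`-multiples are both close to the same
real number modulo one agree modulo one. -/
theorem exists_int_sub_sub_eq {w R M : ℕ} (hM : ∀ l, l.Prime → l ∣ M → l ≤ w) (θ : ℝ)
    {x y x' y' : ℚ} (hx : x ∈ fareyPoints w R) (hy : y ∈ fareyPoints w R)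
    (hx' : x' ∈ fareyPoints w R) (hy' : y' ∈ fareyPoints w R)
    (h : ‖expi (((x - y : ℚ) : ℝ) * M - θ) - 1‖ < 1 / (2 * (R : ℝ) ^ 4))
    (h' : ‖expi (((x' - y' : ℚ) : ℝ) * M - θ) - 1‖ < 1 / (2 * (R : ℝ) ^ 4)) :
    ∃ k : ℤ, x - y = x' - y' + k := by
  have hx := (mem_fareyPoints hx).2.2
  have hy := (mem_fareyPoints hy).2.2
  have hx' := (mem_fareyPoints hx').2.2
  have hy' := (mem_fareyPoints hy').2.2
  have bound : ∀ {q}, q ∈ roughSquarefree w R → q ≤ R := fun hq => (mem_roughSquarefree.1 hq).1.2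
  have hR : 0 < R := (mem_roughSquarefree.1 hx).1.1.trans (bound hx)
  have hR' : (0 : ℝ) < R := by exact_mod_cast hR
  set t : ℚ := (x - y) - (x' - y') with ht
  have htd : t.den ∣ (x.den * y.den) * (x'.den * y'.den) :=
    (Rat.sub_den_dvd _ _).trans (mul_dvd_mul (Rat.sub_den_dvd _ _) (Rat.sub_den_dvd _ _))
  have hcop : M.Coprime t.den := by
    refine Nat.Coprime.coprime_dvd_right htd ?_
    have hc : ∀ {q}, q ∈ roughSquarefree w R → M.Coprime q := coprime_of_mem_roughSquarefree hM
    exact ((hc hx).mul_right (hc hy)).mul_right ((hc hx').mul_right (hc hy'))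
  have htle : t.den ≤ R ^ 4 := by
    have hpos : 0 < (x.den * y.den) * (x'.den * y'.den) := by
      have := x.den_pos; have := y.den_pos; have := x'.den_pos; have := y'.den_pos
      positivity
    calc t.den ≤ (x.den * y.den) * (x'.den * y'.den) := Nat.le_of_dvd hpos htd
      _ ≤ (R * R) * (R * R) :=
        Nat.mul_le_mul (Nat.mul_le_mul (bound hx) (bound hy))
          (Nat.mul_le_mul (bound hx') (bound hy'))
      _ = R ^ 4 := by ring
  have hden : (M * t).den ∣ t.den := by
    have := Rat.mul_den_dvd (M : ℚ) t
    simpa using this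
  have hclose : ‖expi ((M * t : ℚ) : ℝ) - 1‖ < 1 / (R : ℝ) ^ 4 := by
    set u := expi (((x - y : ℚ) : ℝ) * M - θ) with hu
    set u' := expi (((x' - y' : ℚ) : ℝ) * M - θ) with hu'
    have hmul : u = expi ((M * t : ℚ) : ℝ) * u' := by
      rw [hu, hu', ← expi_add]
      congr 1
      rw [ht]
      push_cast
      ring
    have h1 : ‖expi ((M * t : ℚ) : ℝ) - 1‖ = ‖u - u'‖ := by
      rw [hmul, ← sub_one_mul, norm_mul, norm_expi, mul_one]
    have h2 : u - u' = (u - 1) - (u' - 1) := by ring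
    rw [h1, h2]
    refine (norm_sub_le _ _).trans_lt ?_
    have : 1 / (2 * (R : ℝ) ^ 4) + 1 / (2 * (R : ℝ) ^ 4) = 1 / (R : ℝ) ^ 4 := by
      field_simp; norm_num
    linarith
  have hone : (M * t).den = 1 := by
    apply den_eq_one_of_norm_expi_sub_one_lt
    have h1 : ((M * t).den : ℝ) ≤ R ^ 4 := by
      exact_mod_cast (Nat.le_of_dvd t.den_pos hden).trans htle
    calc ((M * t).den : ℝ) * ‖expi ((M * t : ℚ) : ℝ) - 1‖
        ≤ R ^ 4 * ‖expi ((M * t : ℚ) : ℝ) - 1‖ := mul_le_mul_of_nonneg_right h1 (norm_nonneg _)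
      _ < R ^ 4 * (1 / (R : ℝ) ^ 4) := mul_lt_mul_of_pos_left hclose (by positivity)
      _ = 1 := by field_simp
  have hdvd : t.den ∣ M := by
    have h1 : (M : ℚ) * t.num = (M * t).num * t.den := by
      have h2 : (M * t : ℚ) = (M * t).num := by
        conv_lhs => rw [← Rat.num_div_den (M * t), hone]
        simp
      rw [← h2, mul_assoc, mul_comm t, Rat.den_mul_eq_num]
    have h3 : (M : ℤ) * t.num = (M * t).num * t.den := by exact_mod_cast h1
    have h4 : (t.den : ℤ) ∣ M * t.num := Dvd.intro_left _ h3.symm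
    have h5 : IsCoprime (t.den : ℤ) t.num := by
      rw [Int.isCoprime_iff_gcd_eq_one, Int.gcd_comm]
      exact t.reduced
    exact_mod_cast h5.dvd_of_dvd_mul_right h4
  have htone : t.den = 1 := hcop.symm.eq_one_of_dvd hdvd
  refine ⟨t.num, ?_⟩
  have h6 : t = t.num := by
    conv_lhs => rw [← Rat.num_div_den t, htone]
    simp
  rw [← h6, ht]
  ring

theorem eq_of_sub_eq_int {x y : ℚ} (hx : 0 ≤ x) (hx1 : x < 1) (hy : 0 ≤ y) (hy1 : y < 1) {k : ℤ}
    (h : x - y = k) : x = y := by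
  have h1 : (k : ℚ) < 1 := by linarith
  have h2 : (-1 : ℚ) < k := by linarith
  have h3 : k < 1 := by exact_mod_cast h1
  have h4 : -1 < k := by exact_mod_cast h2
  obtain rfl : k = 0 := by omega
  simpa [sub_eq_zero] using h

/-- Cauchy–Schwarz along a partial matching, in which one of the two sides is small. -/
theorem sum_mul_le_of_injOn {s : Finset (ℚ × ℚ)} {A B : Finset ℚ} {f : ℚ → ℝ} {a b : ℝ}
    (h1 : Set.InjOn Prod.fst (s : Set (ℚ × ℚ))) (h2 : Set.InjOn Prod.snd (s : Set (ℚ × ℚ)))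
    (hA : ∀ e ∈ s, e.1 ∈ A) (hB : ∀ e ∈ s, e.2 ∈ B)
    (ha : ∑ x ∈ A, f x ^ 2 ≤ a) (hb : ∑ x ∈ B, f x ^ 2 ≤ b) :
    ∑ e ∈ s, f e.1 * f e.2 ≤ Real.sqrt (a * b) := by
  apply Real.le_sqrt_of_sq_le
  refine (sum_mul_sq_le_sq_mul_sq s _ _).trans ?_
  have ha' : ∑ e ∈ s, f e.1 ^ 2 ≤ a := by
    rw [← sum_image (f := fun x => f x ^ 2) h1]
    exact (sum_le_sum_of_subset_of_nonneg (image_subset_iff.2 hA)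
      fun _ _ _ => sq_nonneg _).trans ha
  have hb' : ∑ e ∈ s, f e.2 ^ 2 ≤ b := by
    rw [← sum_image (f := fun x => f x ^ 2) h2]
    exact (sum_le_sum_of_subset_of_nonneg (image_subset_iff.2 hB)
      fun _ _ _ => sq_nonneg _).trans hb
  exact mul_le_mul ha' hb' (sum_nonneg fun _ _ => sq_nonneg _)
    ((sum_nonneg fun _ _ => sq_nonneg _).trans ha')

theorem sum_near_pairs_le {w R M : ℕ} (hw : 1 ≤ w) (hM : ∀ l, l.Prime → l ∣ M → l ≤ w) (θ : ℝ) :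
    ∑ e ∈ (fareyPoints w R).offDiag with
        ‖expi (((e.1 - e.2 : ℚ) : ℝ) * M - θ) - 1‖ < 1 / (2 * (R : ℝ) ^ 4),
      1 / (e.1.den.totient : ℝ) * (1 / (e.2.den.totient : ℝ))
      ≤ 2 * selbergSum w R / Real.sqrt w := by
  set E := (fareyPoints w R).offDiag.filter
    fun e => ‖expi (((e.1 - e.2 : ℚ) : ℝ) * M - θ) - 1‖ < 1 / (2 * (R : ℝ) ^ 4) with hE
  have hJ : 0 ≤ selbergSum w R := sum_nonneg fun _ _ => by positivity
  rcases E.eq_empty_or_nonempty with h0 | ⟨⟨x₀, y₀⟩, he₀⟩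
  · rw [h0, sum_empty]; positivity
  have memE : ∀ e ∈ E, e.1 ∈ fareyPoints w R ∧ e.2 ∈ fareyPoints w R ∧ e.1 ≠ e.2 ∧
      ‖expi (((e.1 - e.2 : ℚ) : ℝ) * M - θ) - 1‖ < 1 / (2 * (R : ℝ) ^ 4) := by
    intro e he
    rw [hE, mem_filter, mem_offDiag] at he
    tauto
  have hdiff : ∀ e ∈ E, ∀ e' ∈ E, ∃ k : ℤ, e.1 - e.2 = e'.1 - e'.2 + k := by
    intro e he e' he'
    obtain ⟨h1, h2, -, h3⟩ := memE e he
    obtain ⟨h1', h2', -, h3'⟩ := memE e' he'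
    exact exists_int_sub_sub_eq hM θ h1 h2 h1' h2' h3 h3'
  have hinj1 : Set.InjOn Prod.fst (E : Set (ℚ × ℚ)) := by
    intro e he e' he' h
    obtain ⟨k, hk⟩ := hdiff e' he' e he
    have ha := mem_fareyPoints (memE e he).2.1
    have hb := mem_fareyPoints (memE e' he').2.1
    exact Prod.ext h (eq_of_sub_eq_int ha.1 ha.2.1 hb.1 hb.2.1 (k := k) (by linarith))
  have hinj2 : Set.InjOn Prod.snd (E : Set (ℚ × ℚ)) := by
    intro e he e' he' h
    obtain ⟨k, hk⟩ := hdiff e he e' he'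
    have ha := mem_fareyPoints (memE e he).1
    have hb := mem_fareyPoints (memE e' he').1
    exact Prod.ext (eq_of_sub_eq_int ha.1 ha.2.1 hb.1 hb.2.1 (k := k) (by linarith)) h
  obtain ⟨hx₀, hy₀, hne, -⟩ := memE _ he₀
  have hden : (x₀ - y₀).den ≠ 1 := by
    intro h
    have ha := mem_fareyPoints hx₀
    have hb := mem_fareyPoints hy₀
    refine hne (eq_of_sub_eq_int ha.1 ha.2.1 hb.1 hb.2.1 (k := (x₀ - y₀).num) ?_)
    conv_lhs => rw [← Rat.num_div_den (x₀ - y₀), h]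
    simp
  set l := (x₀ - y₀).den.minFac with hl
  have hlp : l.Prime := Nat.minFac_prime hden
  have hldvd : ∀ e ∈ E, l ∣ e.1.den ∨ l ∣ e.2.den := by
    intro e he
    obtain ⟨k, hk⟩ := hdiff e he _ he₀
    have h1 : (e.1 - e.2).den = (x₀ - y₀).den := by
      rw [hk]
      exact Rat.add_intCast_den _ _
    rw [← hlp.dvd_mul]
    exact ((Nat.minFac_dvd _).trans h1.symm.dvd).trans (Rat.sub_den_dvd _ _)
  have hlw : w < l := by
    rcases hldvd _ he₀ with h | h
    · exact (mem_roughSquarefree.1 (mem_fareyPoints hx₀).2.2).2.2 l hlp h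
    · exact (mem_roughSquarefree.1 (mem_fareyPoints hy₀).2.2).2.2 l hlp h
  have hall := (sum_fareyPoints_totient_sq w R).le
  have hpart := sum_fareyPoints_dvd_totient_sq_le w R l hlp hlw hw
  have hsub1 : ∀ (P : ℚ × ℚ → Prop) [DecidablePred P],
      ((E.filter P : Finset (ℚ × ℚ)) : Set (ℚ × ℚ)) ⊆ E := fun P _ => by
    exact_mod_cast filter_subset _ _
  have hsqrt : Real.sqrt (selbergSum w R / w * selbergSum w R) = selbergSum w R / Real.sqrt w := by
    rw [show selbergSum w R / w * selbergSum w R = selbergSum w R ^ 2 / w by ring,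
      Real.sqrt_div (sq_nonneg _), Real.sqrt_sq hJ]
  rw [← sum_filter_add_sum_filter_not E (fun e => l ∣ e.1.den)]
  have hfst := sum_mul_le_of_injOn (f := fun x : ℚ => 1 / (x.den.totient : ℝ))
    (hinj1.mono (hsub1 fun e => l ∣ e.1.den)) (hinj2.mono (hsub1 fun e => l ∣ e.1.den))
    (A := {x ∈ fareyPoints w R | l ∣ x.den}) (B := fareyPoints w R)
    (fun e he => by
      rw [mem_filter] at he ⊢
      exact ⟨(memE e he.1).1, he.2⟩)
    (fun e he => (memE e (mem_filter.1 he).1).2.1) hpart hall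
  have hsnd := sum_mul_le_of_injOn (f := fun x : ℚ => 1 / (x.den.totient : ℝ))
    (hinj1.mono (hsub1 fun e => ¬ l ∣ e.1.den)) (hinj2.mono (hsub1 fun e => ¬ l ∣ e.1.den))
    (A := fareyPoints w R) (B := {x ∈ fareyPoints w R | l ∣ x.den})
    (fun e he => (memE e (mem_filter.1 he).1).1)
    (fun e he => by
      rw [mem_filter] at he ⊢
      exact ⟨(memE e he.1).2.1, (hldvd e he.1).resolve_left he.2⟩) hall hpart
  rw [hsqrt] at hfst
  rw [mul_comm, hsqrt] at hsnd
  calc _ ≤ selbergSum w R / Real.sqrt w + selbergSum w R / Real.sqrt w := add_le_add hfst hsnd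
    _ = _ := by ring

/-- The kernel whose square is Selberg's upper bound sieve weight. -/
noncomputable def sieveKernel (w R : ℕ) (k : ℤ) : ℂ :=
  ∑ x ∈ fareyPoints w R,
    ((ArithmeticFunction.moebius x.den / x.den.totient : ℝ) : ℂ) * expi ((x : ℝ) * k)

theorem sieveKernel_eq_selbergSum {w R : ℕ} {k : ℤ}
    (hk : ∀ q ∈ roughSquarefree w R, IsCoprime k (q : ℤ)) :
    sieveKernel w R k = (selbergSum w R : ℂ) := by
  rw [sieveKernel, sum_fareyPoints, selbergSum, Complex.ofReal_sum]
  refine sum_congr rfl fun q hq => ?_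
  have hq0 := (mem_roughSquarefree.1 hq).1.1
  rw [sum_congr rfl fun a ha => by rw [den_natCast_div hq0 (mem_filter.1 ha).2], ← mul_sum,
    sum_coprime_expi q hq0 k (hk q hq)]
  have h1 : ((ArithmeticFunction.moebius q : ℤ) : ℂ) ^ 2 = 1 := by
    exact_mod_cast ArithmeticFunction.moebius_sq_eq_one_of_squarefree (mem_roughSquarefree.1 hq).2.1
  push_cast
  rw [div_mul_eq_mul_div, ← sq, h1]

theorem norm_sieveKernel_sq (w R : ℕ) (k : ℤ) :
    ((‖sieveKernel w R k‖ ^ 2 : ℝ) : ℂ)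
      = ∑ e ∈ fareyPoints w R ×ˢ fareyPoints w R,
        (((ArithmeticFunction.moebius e.1.den / e.1.den.totient : ℝ) : ℂ) *
          ((ArithmeticFunction.moebius e.2.den / e.2.den.totient : ℝ) : ℂ)) *
          expi (((e.1 - e.2 : ℚ) : ℝ) * k) := by
  rw [Complex.ofReal_pow, ← Complex.mul_conj', sieveKernel, map_sum, sum_mul_sum, sum_product]
  refine sum_congr rfl fun x _ => sum_congr rfl fun y _ => ?_
  rw [map_mul, Complex.conj_ofReal, conj_expi, mul_mul_mul_comm, ← expi_add]
  push_cast
  ring_nf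

theorem norm_geom_sum_expi_le (N : ℕ) (α : ℝ) : ‖∑ n ∈ range N, expi (n * α)‖ ≤ N := by
  refine (norm_sum_le _ _).trans ?_
  simp [norm_expi]

theorem norm_geom_sum_expi_mul_le (N : ℕ) (α : ℝ) :
    ‖∑ n ∈ range N, expi (n * α)‖ * ‖expi α - 1‖ ≤ 2 := by
  simp only [expi_nat_mul]
  rw [← norm_mul, geom_sum_mul]
  refine (norm_sub_le _ _).trans ?_
  rw [norm_pow, norm_expi]
  norm_num

theorem geom_sum_expi_eq_zero {N m : ℕ} (hm : 0 < m) (hmN : m < N) :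
    ∑ n ∈ range N, expi (n * (-((m : ℝ) / N))) = 0 := by
  have hN : (N : ℝ) ≠ 0 := by
    have : 0 < N := by omega
    positivity
  simp only [expi_nat_mul]
  have hne : expi (-((m : ℝ) / N)) - 1 ≠ 0 := by
    rw [sub_ne_zero]
    intro h
    obtain ⟨k, hk⟩ := (expi_eq_one_iff _).1 h
    have h1 : -(m : ℝ) = k * N := by rw [← hk]; field_simp
    have h2 : -(m : ℤ) = k * N := by exact_mod_cast h1
    have h3 : (N : ℤ) ∣ m := ⟨-k, by linarith⟩
    have h4 : N ∣ m := by exact_mod_cast h3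
    exact absurd (Nat.le_of_dvd hm h4) (by omega)
  have h := geom_sum_mul (expi (-((m : ℝ) / N))) N
  rw [← expi_nat_mul, show (N : ℝ) * (-((m : ℝ) / N)) = ((-m : ℤ) : ℝ) by
    push_cast; field_simp, expi_intCast, sub_self] at h
  exact (mul_eq_zero.1 h).resolve_right hne

theorem norm_fourier_sieveKernel_le {w R M : ℕ} (hw : 1 ≤ w) (hR : 1 ≤ R)
    (hM : ∀ l, l.Prime → l ∣ M → l ≤ w) (b : ℤ) (N m : ℕ) (hmN : m < N) :
    ‖∑ n ∈ range N, ((‖sieveKernel w R (b + n * M)‖ ^ 2 : ℝ) : ℂ) * expi (n * (-((m : ℝ) / N)))‖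
      ≤ (if m = 0 then N * selbergSum w R else 0)
        + N * (2 * selbergSum w R / Real.sqrt w) + 4 * (R : ℝ) ^ 8 := by
  set F := fareyPoints w R
  set c : ℚ → ℝ := fun x => ArithmeticFunction.moebius x.den / x.den.totient with hc
  set α : ℚ × ℚ → ℝ := fun e => ((e.1 - e.2 : ℚ) : ℝ) * M - (m : ℝ) / N with hα
  set G : ℝ → ℂ := fun t => ∑ n ∈ range N, expi (n * t) with hG
  have hR' : (1 : ℝ) ≤ R := by exact_mod_cast hR
  have hexpand : ∑ n ∈ range N,
        ((‖sieveKernel w R (b + n * M)‖ ^ 2 : ℝ) : ℂ) * expi (n * (-((m : ℝ) / N)))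
      = ∑ e ∈ F ×ˢ F, ((c e.1 : ℂ) * (c e.2 : ℂ) * expi (((e.1 - e.2 : ℚ) : ℝ) * b)) * G (α e) := by
    simp only [norm_sieveKernel_sq, sum_mul, hG, mul_sum]
    rw [sum_comm]
    refine sum_congr rfl fun e _ => sum_congr rfl fun n _ => ?_
    rw [mul_assoc, mul_assoc ((c e.1 : ℂ) * (c e.2 : ℂ)), ← expi_add, ← expi_add]
    simp only [hα, hc]
    push_cast
    ring_nf
  have hcle : ∀ x, |c x| ≤ 1 / (x.den.totient : ℝ) := by
    intro x
    rw [hc]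
    simp only [abs_div, Nat.abs_cast]
    refine div_le_div_of_nonneg_right ?_ (by positivity)
    exact_mod_cast ArithmeticFunction.abs_moebius_le_one
  have hφ : ∀ x : ℚ, 1 / (x.den.totient : ℝ) ≤ 1 := by
    intro x
    have : (1 : ℝ) ≤ x.den.totient := by exact_mod_cast Nat.totient_pos.2 x.den_pos
    rw [div_le_one (by linarith)]
    exact this
  have hterm : ∀ e : ℚ × ℚ,
      ‖((c e.1 : ℂ) * (c e.2 : ℂ) * expi (((e.1 - e.2 : ℚ) : ℝ) * b)) * G (α e)‖
        ≤ 1 / (e.1.den.totient : ℝ) * (1 / (e.2.den.totient : ℝ)) * ‖G (α e)‖ := by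
    intro e
    rw [norm_mul, norm_mul, norm_mul, norm_expi, mul_one, Complex.norm_real, Complex.norm_real,
      Real.norm_eq_abs, Real.norm_eq_abs]
    exact mul_le_mul_of_nonneg_right
      (mul_le_mul (hcle _) (hcle _) (abs_nonneg _) (by positivity)) (norm_nonneg _)
  have hdiag : ‖∑ e ∈ F.diag,
      ((c e.1 : ℂ) * (c e.2 : ℂ) * expi (((e.1 - e.2 : ℚ) : ℝ) * b)) * G (α e)‖
        ≤ if m = 0 then N * selbergSum w R else 0 := by
    refine (norm_sum_le _ _).trans ?_
    rw [sum_diag]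
    split_ifs with hm
    · rw [← sum_fareyPoints_totient_sq, mul_sum]
      refine sum_le_sum fun x _ => (hterm _).trans ?_
      rw [← sq, mul_comm]
      exact mul_le_mul_of_nonneg_right (norm_geom_sum_expi_le _ _) (by positivity)
    · refine (sum_eq_zero fun x _ => ?_).le
      have : G (α (x, x)) = 0 := by
        simp only [hα, hG, sub_self, Rat.cast_zero, zero_mul, zero_sub]
        exact geom_sum_expi_eq_zero (by omega) hmN
      rw [this, mul_zero, norm_zero]
  have hoff : ‖∑ e ∈ F.offDiag,
      ((c e.1 : ℂ) * (c e.2 : ℂ) * expi (((e.1 - e.2 : ℚ) : ℝ) * b)) * G (α e)‖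
        ≤ N * (2 * selbergSum w R / Real.sqrt w) + 4 * (R : ℝ) ^ 8 := by
    refine (norm_sum_le _ _).trans ?_
    rw [← sum_filter_add_sum_filter_not F.offDiag
      (fun e => ‖expi (α e) - 1‖ < 1 / (2 * (R : ℝ) ^ 4))]
    refine add_le_add ?_ ?_
    · refine le_trans ?_ (mul_le_mul_of_nonneg_left
        (sum_near_pairs_le hw hM ((m : ℝ) / N)) (Nat.cast_nonneg N))
      rw [mul_sum]
      refine sum_le_sum fun e _ => (hterm e).trans ?_
      rw [mul_comm]
      exact mul_le_mul_of_nonneg_right (norm_geom_sum_expi_le _ _) (by positivity)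
    · calc _ ≤ ∑ e ∈ F.offDiag with ¬ ‖expi (α e) - 1‖ < 1 / (2 * (R : ℝ) ^ 4),
              4 * (R : ℝ) ^ 4 := by
            refine sum_le_sum fun e he => (hterm e).trans ?_
            have h1 : 1 / (2 * (R : ℝ) ^ 4) ≤ ‖expi (α e) - 1‖ := not_lt.1 (mem_filter.1 he).2
            have h2 : ‖G (α e)‖ * ‖expi (α e) - 1‖ ≤ 2 := norm_geom_sum_expi_mul_le N (α e)
            have h3 : ‖G (α e)‖ * (1 / (2 * (R : ℝ) ^ 4)) ≤ 2 :=
              (mul_le_mul_of_nonneg_left h1 (norm_nonneg _)).trans h2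
            have h4 : ‖G (α e)‖ ≤ 4 * (R : ℝ) ^ 4 := by
              rw [mul_one_div, div_le_iff₀ (by positivity)] at h3
              linarith
            refine le_trans ?_ h4
            exact mul_le_of_le_one_left (norm_nonneg _)
              (mul_le_one₀ (hφ _) (by positivity) (hφ _))
        _ ≤ (F.card * F.card : ℝ) * (4 * (R : ℝ) ^ 4) := by
            rw [sum_const, nsmul_eq_mul]
            refine mul_le_mul_of_nonneg_right ?_ (by positivity)
            have h1 := card_le_card (filter_subset
              (fun e => ¬ ‖expi (α e) - 1‖ < 1 / (2 * (R : ℝ) ^ 4)) F.offDiag)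
            have h2 : F.offDiag.card ≤ F.card * F.card := by
              rw [offDiag_card]; omega
            exact_mod_cast h1.trans h2
        _ ≤ ((R : ℝ) ^ 2 * (R : ℝ) ^ 2) * (4 * (R : ℝ) ^ 4) := by
            have := card_fareyPoints_le w R
            gcongr
        _ = 4 * (R : ℝ) ^ 8 := by ring
  rw [hexpand, ← diag_union_offDiag, sum_union (disjoint_diag_offDiag F)]
  refine (norm_add_le _ _).trans ?_
  rw [add_assoc]
  exact add_le_add hdiag hoff

theorem sum_rpow_le_of_card_mul_sq_le {ι : Type*} (s : Finset ι) (v : ι → ℝ) {p B D : ℝ}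
    (hp : 2 < p) (hB : 0 < B) (hv : ∀ i ∈ s, 0 < v i) (hvB : ∀ i ∈ s, v i ≤ B)
    (hD : ∀ δ : ℝ, 0 < δ → (#{i ∈ s | δ ≤ v i} : ℝ) * δ ^ 2 ≤ D) :
    ∑ i ∈ s, v i ^ p ≤ 4 * D * B ^ (p - 2) / (1 - (1 / 2 : ℝ) ^ (p - 2)) := by
  classical
  set r : ℝ := (1 / 2 : ℝ) ^ (p - 2) with hr
  have hr0 : 0 < r := by positivity
  have hr1 : r < 1 := Real.rpow_lt_one (by norm_num) (by norm_num) (by linarith)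
  have hD0 : 0 ≤ D := le_trans (by positivity) (hD 1 one_pos)
  have hex : ∀ i, ∃ j : ℕ, i ∈ s → (1 / 2 : ℝ) ^ (j + 1) < v i / B ∧ v i / B ≤ (1 / 2) ^ j := by
    intro i
    by_cases hi : i ∈ s
    · obtain ⟨j, hj⟩ := exists_nat_pow_near_of_lt_one (div_pos (hv i hi) hB)
        ((div_le_one hB).2 (hvB i hi)) (by norm_num : (0 : ℝ) < 1 / 2) (by norm_num)
      exact ⟨j, fun _ => hj⟩
    · exact ⟨0, fun h => absurd h hi⟩
  choose j hj using hex
  obtain ⟨J, hJ⟩ : ∃ J, ∀ i ∈ s, j i ∈ range J :=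
    ⟨s.sup j + 1, fun i hi => mem_range.2 (Nat.lt_succ_of_le (le_sup hi))⟩
  have hfiber : ∀ k : ℕ, ∑ i ∈ s with j i = k, v i ^ p ≤ 4 * D * B ^ (p - 2) * r ^ k := by
    intro k
    set δ : ℝ := B * (1 / 2) ^ (k + 1) with hδ
    have hδ0 : 0 < δ := by positivity
    calc ∑ i ∈ s with j i = k, v i ^ p
        ≤ ∑ i ∈ s with j i = k, (B ^ (p - 2) * r ^ k) * (4 * δ ^ 2) := by
          refine sum_le_sum fun i hi => ?_
          obtain ⟨hs, rfl⟩ := mem_filter.1 hi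
          have h1 : v i ≤ B * (1 / 2) ^ j i := by
            have := (hj i hs).2
            rw [div_le_iff₀ hB] at this
            linarith
          have h2 : v i ^ p = v i ^ (p - 2) * v i ^ 2 := by
            rw [← Real.rpow_natCast, ← Real.rpow_add (hv i hs)]
            norm_num
          have h3 : v i ^ (p - 2) ≤ B ^ (p - 2) * r ^ j i := by
            refine (Real.rpow_le_rpow (hv i hs).le h1 (by linarith)).trans (le_of_eq ?_)
            rw [Real.mul_rpow hB.le (by positivity), hr, ← Real.rpow_natCast,
              ← Real.rpow_natCast, ← Real.rpow_mul (by norm_num), ← Real.rpow_mul (by norm_num),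
              mul_comm (p - 2)]
          have h4 : v i ^ 2 ≤ 4 * δ ^ 2 := by
            have : v i ≤ 2 * δ := by rw [hδ, pow_succ]; linarith
            have := pow_le_pow_left₀ (hv i hs).le this 2
            linarith
          rw [h2]
          exact mul_le_mul h3 h4 (sq_nonneg _) (by positivity)
      _ = (B ^ (p - 2) * r ^ k) * 4 * (#{i ∈ s | j i = k} * δ ^ 2) := by
          rw [sum_const, nsmul_eq_mul]; ring
      _ ≤ (B ^ (p - 2) * r ^ k) * 4 * D := by
          refine mul_le_mul_of_nonneg_left (le_trans ?_ (hD δ hδ0)) (by positivity)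
          refine mul_le_mul_of_nonneg_right ?_ (by positivity)
          have : {i ∈ s | j i = k} ⊆ {i ∈ s | δ ≤ v i} := by
            intro i hi
            obtain ⟨hs, rfl⟩ := mem_filter.1 hi
            refine mem_filter.2 ⟨hs, ?_⟩
            have := (hj i hs).1
            rw [lt_div_iff₀ hB] at this
            rw [hδ]
            linarith
          exact_mod_cast card_le_card this
      _ = _ := by ring
  rw [← sum_fiberwise_of_maps_to hJ]
  calc _ ≤ ∑ k ∈ range J, 4 * D * B ^ (p - 2) * r ^ k := sum_le_sum fun k _ => hfiber k
    _ = 4 * D * B ^ (p - 2) * ∑ k ∈ range J, r ^ k := by rw [mul_sum]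
    _ ≤ 4 * D * B ^ (p - 2) * (1 / (1 - r)) := by
        refine mul_le_mul_of_nonneg_left ?_ (by positivity)
        rw [le_div_iff₀ (by linarith), geom_sum_mul_neg]
        have : 0 ≤ r ^ J := by positivity
        linarith
    _ = _ := by ring

theorem dft_eq_sum_stdAddChar {N : ℕ} [NeZero N] (f : ZMod N → ℂ) (m : ZMod N) :
    dft f m = ∑ n, f n * ZMod.stdAddChar (-(n * m)) := by
  refine sum_congr rfl fun n _ => ?_
  congr 1
  have h : -(n * m) = ((-(n.val * m.val : ℤ) : ℤ) : ZMod N) := by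
    push_cast
    simp
  rw [h, ZMod.stdAddChar_coe]
  push_cast
  ring_nf

theorem dft_zero_right {N : ℕ} [NeZero N] (f : ZMod N → ℂ) : dft f 0 = ∑ n, f n := by
  simp [dft_eq_sum_stdAddChar]

theorem conj_stdAddChar {N : ℕ} [NeZero N] (x : ZMod N) :
    (starRingEnd ℂ) (ZMod.stdAddChar x) = ZMod.stdAddChar (-x) :=
  (AddChar.map_neg_eq_conj _ _).symm

theorem sum_norm_dft_sq {N : ℕ} [NeZero N] (a : ZMod N → ℝ) :
    ∑ m, ‖dft (fun n => (a n : ℂ)) m‖ ^ 2 = N * ∑ n, a n ^ 2 := by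
  have h : ((∑ m, ‖dft (fun n => (a n : ℂ)) m‖ ^ 2 : ℝ) : ℂ) = ((N * ∑ n, a n ^ 2 : ℝ) : ℂ) := by
    rw [Complex.ofReal_sum]
    simp only [Complex.ofReal_pow, ← Complex.mul_conj', dft_eq_sum_stdAddChar, map_sum, map_mul,
      Complex.conj_ofReal, conj_stdAddChar, neg_neg, sum_mul_sum]
    rw [sum_comm]
    push_cast
    rw [mul_sum]
    refine sum_congr rfl fun n _ => ?_
    rw [sum_comm]
    have hinner : ∀ n', ∑ m : ZMod N, (a n : ℂ) * ZMod.stdAddChar (-(n * m)) *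
        ((a n' : ℂ) * ZMod.stdAddChar (n' * m)) = if n' = n then (N : ℂ) * (a n * a n') else 0 := by
      intro n'
      have h1 := AddChar.sum_mulShift (n' - n) (ZMod.isPrimitive_stdAddChar N)
      have h2 : ∑ m : ZMod N, (a n : ℂ) * ZMod.stdAddChar (-(n * m)) *
          ((a n' : ℂ) * ZMod.stdAddChar (n' * m))
          = (a n * a n') * ∑ m : ZMod N, ZMod.stdAddChar (m * (n' - n)) := by
        rw [mul_sum]
        refine sum_congr rfl fun m _ => ?_
        rw [mul_mul_mul_comm, ← AddChar.map_add_eq_mul]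
        ring_nf
      rw [h2, h1]
      simp only [sub_eq_zero, ZMod.card]
      split_ifs <;> simp [mul_comm]
    simp only [hinner, sum_ite_eq', mem_univ, if_true, sq]
  exact_mod_cast h

theorem exists_norm_le_one_mul_eq_norm (x : ℂ) : ∃ c : ℂ, ‖c‖ ≤ 1 ∧ c * x = ‖x‖ := by
  by_cases hx : x = 0
  · exact ⟨0, by simp [hx]⟩
  · have h : (‖x‖ : ℂ) ≠ 0 := by simpa using hx
    refine ⟨(starRingEnd ℂ) x / ‖x‖, by simp [div_self_le_one], ?_⟩
    rw [div_mul_eq_mul_div, mul_comm, Complex.mul_conj']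
    field_simp

/-- Large spectrum estimate for a function dominated by a pseudorandom majorant. -/
theorem sq_sum_norm_dft_le {N : ℕ} [NeZero N] {B η : ℝ} (hη : 0 ≤ η)
    {a ν : ZMod N → ℝ} (ha : ∀ n, 0 ≤ a n) (haν : ∀ n, a n ≤ ν n)
    (h0 : ‖dft (fun n => (ν n : ℂ)) 0‖ ≤ B)
    (h : ∀ m, m ≠ 0 → ‖dft (fun n => (ν n : ℂ)) m‖ ≤ B * η) (X : Finset (ZMod N)) :
    (∑ m ∈ X, ‖dft (fun n => (a n : ℂ)) m‖) ^ 2 ≤ B ^ 2 * (#X + η * #X ^ 2) := by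
  classical
  have hB : 0 ≤ B := (norm_nonneg _).trans h0
  choose c hc1 hc using fun m => exists_norm_le_one_mul_eq_norm (dft (fun n => (a n : ℂ)) m)
  set g : ZMod N → ℂ := fun n => ∑ m ∈ X, c m * ZMod.stdAddChar (-(n * m)) with hg
  have hS : ∑ m ∈ X, ‖dft (fun n => (a n : ℂ)) m‖ ≤ ∑ n, a n * ‖g n‖ := by
    have h1 : ((∑ m ∈ X, ‖dft (fun n => (a n : ℂ)) m‖ : ℝ) : ℂ) = ∑ n, (a n : ℂ) * g n := by
      rw [Complex.ofReal_sum]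
      simp only [← hc]
      simp only [dft_eq_sum_stdAddChar, mul_sum, hg]
      rw [sum_comm]
      refine sum_congr rfl fun n _ => sum_congr rfl fun m _ => ?_
      ring
    have h2 : ‖((∑ m ∈ X, ‖dft (fun n => (a n : ℂ)) m‖ : ℝ) : ℂ)‖
        = ∑ m ∈ X, ‖dft (fun n => (a n : ℂ)) m‖ := by
      rw [Complex.norm_real, Real.norm_eq_abs, abs_of_nonneg (sum_nonneg fun _ _ => norm_nonneg _)]
    rw [← h2, h1]
    refine (norm_sum_le _ _).trans (le_of_eq (sum_congr rfl fun n _ => ?_))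
    rw [norm_mul, Complex.norm_real, Real.norm_eq_abs, abs_of_nonneg (ha n)]
  have hν : ∑ n, ν n ≤ B := by
    rw [dft_zero_right, ← Complex.ofReal_sum, Complex.norm_real] at h0
    exact (le_abs_self _).trans h0
  have hcs : (∑ n, a n * ‖g n‖) ^ 2 ≤ (∑ n, a n) * ∑ n, a n * ‖g n‖ ^ 2 := by
    have h1 := sum_mul_sq_le_sq_mul_sq univ (fun n => Real.sqrt (a n))
      (fun n => Real.sqrt (a n) * ‖g n‖)
    simpa only [← mul_assoc, mul_pow, Real.mul_self_sqrt (ha _), Real.sq_sqrt (ha _)] using h1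
  have hquad : ∑ n, ν n * ‖g n‖ ^ 2 ≤ B * (#X + η * #X ^ 2) := by
    have h1 : ((∑ n, ν n * ‖g n‖ ^ 2 : ℝ) : ℂ)
        = ∑ m ∈ X, ∑ m' ∈ X, c m * (starRingEnd ℂ) (c m') * dft (fun n => (ν n : ℂ)) (m - m') := by
      rw [Complex.ofReal_sum]
      simp only [Complex.ofReal_mul, Complex.ofReal_pow, ← Complex.mul_conj', hg, map_sum, map_mul,
        conj_stdAddChar, neg_neg, sum_mul_sum]
      simp only [mul_sum, dft_eq_sum_stdAddChar]
      rw [sum_comm]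
      refine sum_congr rfl fun m _ => ?_
      rw [sum_comm]
      refine sum_congr rfl fun m' _ => sum_congr rfl fun n _ => ?_
      rw [mul_mul_mul_comm (c m), ← AddChar.map_add_eq_mul,
        show -(n * m) + n * m' = -(n * (m - m')) by ring]
      ring
    have h2 : ∑ n, ν n * ‖g n‖ ^ 2 ≤ ‖((∑ n, ν n * ‖g n‖ ^ 2 : ℝ) : ℂ)‖ := by
      rw [Complex.norm_real]; exact le_abs_self _
    refine h2.trans ?_
    rw [h1]
    calc _ ≤ ∑ m ∈ X, ∑ m' ∈ X, ((if m = m' then B else 0) + B * η) := by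
          refine (norm_sum_le _ _).trans (sum_le_sum fun m _ => ?_)
          refine (norm_sum_le _ _).trans (sum_le_sum fun m' _ => ?_)
          rw [norm_mul, norm_mul, RCLike.norm_conj]
          have h3 : ‖dft (fun n => (ν n : ℂ)) (m - m')‖ ≤ (if m = m' then B else 0) + B * η := by
            split_ifs with hm
            · rw [hm, sub_self]
              have : 0 ≤ B * η := by positivity
              linarith
            · rw [zero_add]
              exact h _ (sub_ne_zero.2 hm)
          exact (mul_le_of_le_one_left (norm_nonneg _)
            (mul_le_one₀ (hc1 m) (norm_nonneg _) (hc1 m'))).trans h3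
      _ = B * (#X + η * #X ^ 2) := by
          simp only [sum_add_distrib, sum_ite_eq, sum_const, nsmul_eq_mul]
          rw [sum_congr rfl fun m hm => if_pos hm]
          simp only [sum_const, nsmul_eq_mul]
          ring
  calc _ ≤ (∑ n, a n * ‖g n‖) ^ 2 :=
        pow_le_pow_left₀ (sum_nonneg fun _ _ => norm_nonneg _) hS 2
    _ ≤ (∑ n, a n) * ∑ n, a n * ‖g n‖ ^ 2 := hcs
    _ ≤ B * (B * (#X + η * #X ^ 2)) := by
        refine mul_le_mul ((sum_le_sum fun n _ => haν n).trans hν) (le_trans ?_ hquad)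
          (sum_nonneg fun n _ => mul_nonneg (ha n) (sq_nonneg _)) hB
        exact sum_le_sum fun n _ => mul_le_mul_of_nonneg_right (haν n) (sq_nonneg _)
    _ = _ := by ring

/-- Restriction estimate for a function dominated by a pseudorandom majorant. -/
theorem sum_norm_dft_rpow_le {N : ℕ} [NeZero N] {p B η s : ℝ} (hp : 2 < p) (hB : 0 < B)
    (hη : 0 < η) {a ν : ZMod N → ℝ} (ha : ∀ n, 0 ≤ a n) (haν : ∀ n, a n ≤ ν n)
    (has : ∀ n, a n ≤ s) (h0 : ‖dft (fun n => (ν n : ℂ)) 0‖ ≤ B)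
    (h : ∀ m, m ≠ 0 → ‖dft (fun n => (ν n : ℂ)) m‖ ≤ B * η) :
    ∑ m, ‖dft (fun n => (a n : ℂ)) m‖ ^ p
      ≤ 4 * (2 * B ^ 2) * B ^ (p - 2) / (1 - (1 / 2 : ℝ) ^ (p - 2))
        + (2 * B ^ 2 * η) ^ ((p - 2) / 2) * (N * s * B) := by
  classical
  set v : ZMod N → ℝ := fun m => ‖dft (fun n => (a n : ℂ)) m‖ with hv
  have hv0 : ∀ m, 0 ≤ v m := fun m => norm_nonneg _
  have hsum : ∑ n, a n ≤ B := by
    rw [dft_zero_right, ← Complex.ofReal_sum, Complex.norm_real] at h0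
    exact (sum_le_sum fun n _ => haν n).trans ((le_abs_self _).trans h0)
  have hvB : ∀ m, v m ≤ B := by
    intro m
    refine le_trans ?_ hsum
    simp only [hv, dft_eq_sum_stdAddChar]
    refine (norm_sum_le _ _).trans (le_of_eq (sum_congr rfl fun n _ => ?_))
    rw [norm_mul, AddChar.norm_apply, mul_one, Complex.norm_real, Real.norm_eq_abs,
      abs_of_nonneg (ha n)]
  rw [← sum_filter_add_sum_filter_not univ (fun m => 2 * B ^ 2 * η ≤ v m ^ 2)]
  refine add_le_add ?_ ?_
  · refine sum_rpow_le_of_card_mul_sq_le _ v hp hB ?_ (fun m _ => hvB m) ?_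
    · intro m hm
      have h1 : 0 < v m ^ 2 := lt_of_lt_of_le (by positivity) (mem_filter.1 hm).2
      exact lt_of_le_of_ne (hv0 m) fun h => by rw [← h] at h1; simp at h1
    · intro δ hδ
      set X := {m ∈ ({m ∈ univ | 2 * B ^ 2 * η ≤ v m ^ 2} : Finset (ZMod N)) | δ ≤ v m} with hX
      have hspec := sq_sum_norm_dft_le hη.le ha haν h0 h X
      set t : ℝ := max (δ ^ 2) (2 * B ^ 2 * η) with ht
      have ht0 : 0 < t := lt_max_of_lt_left (by positivity)
      have hlow : (#X : ℝ) * Real.sqrt t ≤ ∑ m ∈ X, v m := by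
        rw [← nsmul_eq_mul, ← sum_const]
        refine sum_le_sum fun m hm => ?_
        simp only [hX, mem_filter, mem_univ, true_and] at hm
        rw [Real.sqrt_le_left (hv0 m)]
        exact max_le (pow_le_pow_left₀ hδ.le hm.2 2) hm.1
      have hlow2 : (#X : ℝ) ^ 2 * t ≤ (∑ m ∈ X, v m) ^ 2 := by
        have := pow_le_pow_left₀ (by positivity) hlow 2
        rwa [mul_pow, Real.sq_sqrt ht0.le] at this
      have hmain : (#X : ℝ) ^ 2 * t ≤ B ^ 2 * (#X + η * #X ^ 2) := hlow2.trans hspec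
      have hηt : 2 * B ^ 2 * η ≤ t := le_max_right _ _
      have hcard : (#X : ℝ) * t ≤ 2 * B ^ 2 := by
        rcases Nat.eq_zero_or_pos #X with h0 | hpos
        · rw [h0, Nat.cast_zero, zero_mul]; positivity
        · have hpos' : (0 : ℝ) < #X := by exact_mod_cast hpos
          have h2 : (#X : ℝ) ^ 2 * (2 * B ^ 2 * η) ≤ (#X : ℝ) ^ 2 * t :=
            mul_le_mul_of_nonneg_left hηt (sq_nonneg _)
          refine le_of_mul_le_mul_left ?_ hpos'
          nlinarith
      exact (mul_le_mul_of_nonneg_left (le_max_left _ _) (Nat.cast_nonneg _)).trans hcard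
  · calc _ ≤ ∑ m with ¬ 2 * B ^ 2 * η ≤ v m ^ 2,
            (2 * B ^ 2 * η) ^ ((p - 2) / 2) * v m ^ 2 := by
          refine sum_le_sum fun m hm => ?_
          have h1 : v m ^ 2 ≤ 2 * B ^ 2 * η := (not_le.1 (mem_filter.1 hm).2).le
          have h2 : v m ^ p = v m ^ (p - 2) * v m ^ 2 := by
            rw [← Real.rpow_natCast, ← Real.rpow_add_of_nonneg (hv0 m) (by linarith) (by norm_num)]
            norm_num
          have h3 : v m ^ (p - 2) = (v m ^ 2) ^ ((p - 2) / 2) := by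
            rw [← Real.rpow_natCast, ← Real.rpow_mul (hv0 m)]
            congr 1
            push_cast
            ring
          change v m ^ p ≤ _
          rw [h2, h3]
          exact mul_le_mul_of_nonneg_right
            (Real.rpow_le_rpow (sq_nonneg _) h1 (by linarith)) (sq_nonneg _)
      _ ≤ ∑ m, (2 * B ^ 2 * η) ^ ((p - 2) / 2) * v m ^ 2 :=
          sum_le_sum_of_subset_of_nonneg (filter_subset _ _) fun _ _ _ => by positivity
      _ = (2 * B ^ 2 * η) ^ ((p - 2) / 2) * (N * ∑ n, a n ^ 2) := by
          rw [← mul_sum, sum_norm_dft_sq]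
      _ ≤ _ := by
          refine mul_le_mul_of_nonneg_left ?_ (by positivity)
          rw [mul_assoc]
          refine mul_le_mul_of_nonneg_left ?_ (Nat.cast_nonneg _)
          have hs : 0 ≤ s := (ha 0).trans (has 0)
          calc ∑ n, a n ^ 2 ≤ ∑ n, s * a n := sum_le_sum fun n _ => by
                rw [sq]; exact mul_le_mul_of_nonneg_right (has n) (ha n)
            _ = s * ∑ n, a n := by rw [mul_sum]
            _ ≤ s * B := mul_le_mul_of_nonneg_left hsum hs

theorem dft_eq_sum_range {N : ℕ} [NeZero N] (F : ℕ → ℂ) (m : ZMod N) :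
    dft (fun n => F n.val) m
      = ∑ n ∈ range N, F n * expi (n * (-((m.val : ℝ) / N))) := by
  rw [dft]
  refine sum_nbij' (fun n => n.val) (fun n => (n : ZMod N)) ?_ ?_ ?_ ?_ ?_
  · exact fun n _ => mem_range.2 n.val_lt
  · exact fun n _ => mem_univ _
  · exact fun n _ => ZMod.natCast_zmod_val n
  · exact fun n hn => ZMod.val_cast_of_lt (mem_range.1 hn)
  · intro n _
    rw [expi]
    push_cast
    ring_nf

theorem dft_add {N : ℕ} [NeZero N] (f g : ZMod N → ℂ) (m : ZMod N) :
    dft (fun n => f n + g n) m = dft f m + dft g m := by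
  simp only [dft, add_mul, sum_add_distrib]

theorem dft_const_mul {N : ℕ} [NeZero N] (c : ℂ) (f : ZMod N → ℂ) (m : ZMod N) :
    dft (fun n => c * f n) m = c * dft f m := by
  simp only [dft, mul_assoc, mul_sum]

theorem norm_dft_le {N : ℕ} [NeZero N] (f : ZMod N → ℂ) (m : ZMod N) :
    ‖dft f m‖ ≤ ∑ n, ‖f n‖ := by
  rw [dft_eq_sum_stdAddChar]
  refine (norm_sum_le _ _).trans (le_of_eq (sum_congr rfl fun n _ => ?_))
  rw [norm_mul, AddChar.norm_apply, mul_one]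

theorem one_le_selbergSum {w R : ℕ} (hR : 1 ≤ R) : 1 ≤ selbergSum w R := by
  have h : (1 : ℕ) ∈ roughSquarefree w R := mem_roughSquarefree.2
    ⟨⟨le_rfl, hR⟩, squarefree_one, fun l hl hd => absurd (Nat.dvd_one.1 hd) hl.one_lt.ne'⟩
  have := single_le_sum (f := fun q : ℕ => (1 : ℝ) / q.totient) (fun _ _ => by positivity) h
  simpa [selbergSum] using this

theorem selbergSum_le (w R : ℕ) : selbergSum w R ≤ R := by
  have h1 : selbergSum w R ≤ ∑ q ∈ roughSquarefree w R, (1 : ℝ) := by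
    refine sum_le_sum fun q hq => ?_
    have hq := Nat.totient_pos.2 (mem_roughSquarefree.1 hq).1.1
    exact (div_le_one (by exact_mod_cast hq)).2 (by exact_mod_cast hq)
  refine h1.trans ?_
  rw [sum_const, nsmul_eq_mul, mul_one]
  have : roughSquarefree w R ⊆ Icc 1 R := fun q hq => mem_Icc.2 (mem_roughSquarefree.1 hq).1
  exact_mod_cast (card_le_card this).trans (by simp)

theorem isCoprime_of_prime_of_lt {w R : ℕ} {k : ℤ} (hk : Prime k) (hR : (R : ℤ) < |k|) :
    ∀ q ∈ roughSquarefree w R, IsCoprime k (q : ℤ) := by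
  intro q hq
  obtain ⟨hq1, hqR⟩ := (mem_roughSquarefree.1 hq).1
  refine hk.coprime_iff_not_dvd.2 fun hd => ?_
  have h1 := Int.le_of_dvd (by exact_mod_cast hq1) ((abs_dvd k (q : ℤ)).2 hd)
  have h2 : (q : ℤ) ≤ R := by exact_mod_cast hqR
  omega

/-- A majorant, with small nonzero Fourier coefficients, for the `n` such that `b + n * M` is
prime. -/
theorem exists_sieve_majorant {w R M : ℕ} (hw : 1 ≤ w) (hR : 1 ≤ R) (hM0 : 0 < M)
    (hM : ∀ l, l.Prime → l ∣ M → l ≤ w) (N : ℕ) [NeZero N] (b : ℤ) :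
    ∃ ν : ZMod N → ℝ, (∀ x, 0 ≤ ν x) ∧
      (∀ n : ℕ, n ≤ N → Prime (b + n * M : ℤ) → 1 ≤ ν n) ∧
      ∀ m, ‖dft (fun x => (ν x : ℂ)) m‖ ≤ (if m = 0 then N / selbergSum w R else 0)
        + 2 * N / (selbergSum w R * Real.sqrt w) + 8 * (R : ℝ) ^ 8 := by
  classical
  set J := selbergSum w R with hJ
  have hJ1 : 1 ≤ J := one_le_selbergSum hR
  have hw0 : 0 < Real.sqrt w := Real.sqrt_pos.2 (by exact_mod_cast hw)
  have hR1 : (1 : ℝ) ≤ R := by exact_mod_cast hR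
  set κ : ZMod N → ℝ := fun x => ‖sieveKernel w R (b + x.val * M)‖ ^ 2 with hκ
  set E : Finset (ZMod N) := {x | x = 0 ∨ |b + x.val * M| ≤ R} with hE
  have hEcard : (#E : ℝ) ≤ 4 * (R : ℝ) ^ 8 := by
    have h1 : E ⊆ insert 0 ({x : ZMod N | |b + x.val * M| ≤ R} : Finset (ZMod N)) := by
      intro x hx
      simpa [hE] using hx
    have h2 : #{x : ZMod N | |b + x.val * M| ≤ R} ≤ #(Icc (-(R : ℤ)) R) := by
      refine card_le_card_of_injOn (fun x => b + x.val * M) ?_ ?_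
      · intro x hx
        simpa [abs_le] using hx
      · intro x _ y _ hxy
        have hM0' : (M : ℤ) ≠ 0 := by exact_mod_cast hM0.ne'
        have : (x.val : ℤ) = y.val := mul_right_cancel₀ hM0' (add_left_cancel hxy)
        exact ZMod.val_injective N (by exact_mod_cast this)
    have h3 : #E ≤ 2 * R + 2 := by
      refine (card_le_card h1).trans ((card_insert_le _ _).trans ?_)
      rw [Int.card_Icc] at h2
      omega
    have h4 : (R : ℝ) ≤ R ^ 8 := le_self_pow₀ hR1 (by norm_num)
    have h5 : (#E : ℝ) ≤ 2 * R + 2 := by exact_mod_cast h3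
    linarith
  refine ⟨fun x => (J ^ 2)⁻¹ * κ x + if x ∈ E then 1 else 0, fun x => ?_, fun n hn hp => ?_,
    fun m => ?_⟩
  · have : (0 : ℝ) ≤ if x ∈ E then 1 else 0 := by split_ifs <;> norm_num
    have : 0 ≤ κ x := sq_nonneg _
    positivity
  · have hκ0 : 0 ≤ (J ^ 2)⁻¹ * κ n := by positivity
    by_cases hnE : (n : ZMod N) ∈ E
    · simp only [hnE, if_true]
      linarith
    · simp only [hnE, if_false, add_zero]
      simp only [hE, mem_filter, mem_univ, true_and, not_or, not_le] at hnE
      have hlt : n < N := by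
        refine lt_of_le_of_ne hn ?_
        rintro rfl
        exact hnE.1 (ZMod.natCast_self n)
      rw [ZMod.val_cast_of_lt hlt] at hnE
      have : κ n = J ^ 2 := by
        simp only [hκ, ZMod.val_cast_of_lt hlt]
        rw [sieveKernel_eq_selbergSum (isCoprime_of_prime_of_lt hp hnE.2), Complex.norm_real,
          Real.norm_eq_abs, sq_abs]
      rw [this, inv_mul_cancel₀ (by positivity)]
  · have hκm : ‖dft (fun x => (κ x : ℂ)) m‖
        ≤ (if m = 0 then N * J else 0) + N * (2 * J / Real.sqrt w) + 4 * (R : ℝ) ^ 8 := by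
      have h1 := norm_fourier_sieveKernel_le hw hR hM b N m.val m.val_lt
      rw [← dft_eq_sum_range fun n => ((‖sieveKernel w R (b + n * M)‖ ^ 2 : ℝ) : ℂ)] at h1
      simpa only [ZMod.val_eq_zero] using h1
    have hEm : ‖dft (fun x => ((if x ∈ E then (1 : ℝ) else 0 : ℝ) : ℂ)) m‖ ≤ 4 * (R : ℝ) ^ 8 := by
      refine (norm_dft_le _ _).trans (le_trans (le_of_eq ?_) hEcard)
      have hnorm : ∀ x, ‖((if x ∈ E then (1 : ℝ) else 0 : ℝ) : ℂ)‖ = if x ∈ E then 1 else 0 := by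
        intro x
        split_ifs <;> simp
      simp only [hnorm, sum_boole, filter_univ_mem]
    simp only [Complex.ofReal_add, Complex.ofReal_mul]
    rw [dft_add, dft_const_mul]
    refine (norm_add_le _ _).trans ?_
    rw [norm_mul, Complex.norm_real, Real.norm_of_nonneg (by positivity)]
    have h2 : (J ^ 2)⁻¹ * ‖dft (fun x => (κ x : ℂ)) m‖ ≤ (if m = 0 then N / J else 0)
        + 2 * N / (J * Real.sqrt w) + 4 * (R : ℝ) ^ 8 := by
      refine (mul_le_mul_of_nonneg_left hκm (by positivity)).trans ?_
      rw [mul_add, mul_add]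
      refine add_le_add (add_le_add (le_of_eq ?_) (le_of_eq ?_)) ?_
      · split_ifs
        · field_simp
        · simp
      · field_simp
      · refine mul_le_of_le_one_left (by positivity) (inv_le_one_of_one_le₀ (one_le_pow₀ hJ1))
    linarith

/-- The restriction estimate for the primes in a residue class, with general sieve parameters. -/
theorem sum_norm_dft_rpow_le_of_prime {w R M N : ℕ} [NeZero N] {p B s : ℝ} (hp : 2 < p)
    (hw : 1 ≤ w) (hR : 2 ≤ R) (hwR : w ≤ R ^ 2) (hRN : R ^ 13 ≤ N) (hM0 : 0 < M)
    (hM : ∀ l, l.Prime → l ∣ M → l ≤ w) (hs : 0 ≤ s) (hB : 0 < B)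
    (hsB : 4 * (s * N) ≤ B * selbergSum w R) (b : ℤ) {A : Finset (ZMod N)}
    (hA : ∀ x ∈ A, ∃ n : ℕ, n ≤ N ∧ Prime (b + n * M : ℤ) ∧ (n : ZMod N) = x) :
    ∑ m, ‖dft (fun n => ((if n ∈ A then s else 0 : ℝ) : ℂ)) m‖ ^ p
      ≤ 4 * (2 * B ^ 2) * B ^ (p - 2) / (1 - (1 / 2 : ℝ) ^ (p - 2))
        + (2 * B ^ 2 * (1 / Real.sqrt w)) ^ ((p - 2) / 2) * (N * s * B) := by
  obtain ⟨ν, hν0, hν1, hν⟩ := exists_sieve_majorant hw (by omega : 1 ≤ R) hM0 hM N b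
  set J := selbergSum w R with hJ
  have hJ1 : 1 ≤ J := one_le_selbergSum (by omega)
  have hJR : J ≤ R := selbergSum_le w R
  have hw1 : 1 ≤ Real.sqrt w := Real.one_le_sqrt.2 (by exact_mod_cast hw)
  have hwR' : Real.sqrt w ≤ R := Real.sqrt_le_left (by positivity) |>.2 (by exact_mod_cast hwR)
  have hR2 : (2 : ℝ) ≤ R := by exact_mod_cast hR
  have herr : 8 * (R : ℝ) ^ 8 ≤ N / (J * Real.sqrt w) := by
    rw [le_div_iff₀ (by positivity)]
    calc 8 * (R : ℝ) ^ 8 * (J * Real.sqrt w) ≤ (R : ℝ) ^ 3 * (R : ℝ) ^ 8 * (R * R) := by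
          have : (8 : ℝ) ≤ (R : ℝ) ^ 3 := by
            have := pow_le_pow_left₀ (by norm_num) hR2 3
            linarith
          gcongr
      _ = (R : ℝ) ^ 13 := by ring
      _ ≤ N := by exact_mod_cast hRN
  have hsJ : 4 * (s * (N / J)) ≤ B := by
    rw [← mul_div_assoc, ← mul_div_assoc, div_le_iff₀ (by positivity)]
    exact hsB
  have hdft : ∀ m, ‖dft (fun x => ((s * ν x : ℝ) : ℂ)) m‖ ≤
      s * ((if m = 0 then N / J else 0) + 3 * (N / J) * (1 / Real.sqrt w)) := by
    intro m
    simp only [Complex.ofReal_mul]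
    rw [dft_const_mul, norm_mul, Complex.norm_real, Real.norm_of_nonneg hs]
    refine mul_le_mul_of_nonneg_left ((hν m).trans ?_) hs
    have h1 : 2 * N / (J * Real.sqrt w) + N / (J * Real.sqrt w)
        = 3 * (N / J) * (1 / Real.sqrt w) := by
      field_simp
      ring
    linarith
  have hNJ : 0 ≤ s * (N / J) := by positivity
  have hη : 1 / Real.sqrt w ≤ 1 := (div_le_one (by positivity)).2 hw1
  refine sum_norm_dft_rpow_le hp hB (by positivity) (ν := fun x => s * ν x) ?_ ?_ ?_ ?_ ?_
  · intro n
    split_ifs <;> simp [hs]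
  · intro n
    split_ifs with hn
    · obtain ⟨k, hk, hkp, rfl⟩ := hA n hn
      exact le_mul_of_one_le_right hs (hν1 k hk hkp)
    · exact mul_nonneg hs (hν0 n)
  · intro n
    split_ifs <;> simp [hs]
  · refine (hdft 0).trans ?_
    rw [if_pos rfl]
    have := mul_le_mul_of_nonneg_left hη hNJ
    linarith
  · intro m hm
    refine (hdft m).trans ?_
    rw [if_neg hm, zero_add]
    have h1 : 3 * (s * (N / J)) ≤ B := by linarith
    calc _ = 3 * (s * (N / J)) * (1 / Real.sqrt w) := by ring
      _ ≤ _ := mul_le_mul_of_nonneg_right h1 (by positivity)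

theorem eventually_sieve_parameters (K : ℕ) : ∀ᶠ N : ℕ in Filter.atTop,
    9 ≤ Real.log N ∧ ⌊Real.log N / 3⌋₊ ^ K ≤ ⌊(N : ℝ) ^ (1 / 40 : ℝ)⌋₊ ^ 2 ∧
      2 ≤ ⌊(N : ℝ) ^ (1 / 40 : ℝ)⌋₊ ∧ Real.log N ≤ 80 * Real.log ⌊(N : ℝ) ^ (1 / 40 : ℝ)⌋₊ := by
  have hlog : Filter.Tendsto (fun N : ℕ => Real.log N) Filter.atTop Filter.atTop :=
    Real.tendsto_log_atTop.comp tendsto_natCast_atTop_atTop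
  have hpow : Filter.Tendsto (fun N : ℕ => (N : ℝ) ^ (1 / 80 : ℝ)) Filter.atTop Filter.atTop :=
    (tendsto_rpow_atTop (by norm_num)).comp tendsto_natCast_atTop_atTop
  have hlittle : ∀ᶠ N : ℕ in Filter.atTop, Real.log N ^ K ≤ (N : ℝ) ^ (1 / 80 : ℝ) := by
    have h := (isLittleO_log_rpow_rpow_atTop (s := 1 / 80) (K : ℝ) (by norm_num)).bound
      (one_pos : (0 : ℝ) < 1)
    filter_upwards [tendsto_natCast_atTop_atTop.eventually h] with N hN
    rw [Real.rpow_natCast, one_mul, Real.norm_of_nonneg (by positivity)] at hN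
    exact hN.trans (le_of_eq (Real.norm_of_nonneg (by positivity)))
  filter_upwards [hlog.eventually_ge_atTop 9, hpow.eventually_ge_atTop 2, hlittle,
    Filter.eventually_ge_atTop 1] with N h9 h2 hK h1
  have hN : (0 : ℝ) < N := by exact_mod_cast h1
  have hsq : (N : ℝ) ^ (1 / 40 : ℝ) = (N : ℝ) ^ (1 / 80 : ℝ) * (N : ℝ) ^ (1 / 80 : ℝ) := by
    rw [← Real.rpow_add hN]
    norm_num
  have hfl := Nat.lt_floor_add_one ((N : ℝ) ^ (1 / 40 : ℝ))
  set R := ⌊(N : ℝ) ^ (1 / 40 : ℝ)⌋₊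
  have hR : (N : ℝ) ^ (1 / 80 : ℝ) ≤ R := by nlinarith
  have hR2 : (2 : ℝ) ≤ R := h2.trans hR
  refine ⟨h9, ?_, by exact_mod_cast hR2, ?_⟩
  · have h3 : (⌊Real.log N / 3⌋₊ : ℝ) ≤ Real.log N :=
      (Nat.floor_le (by positivity)).trans (by linarith)
    have h4 : (⌊Real.log N / 3⌋₊ : ℝ) ^ K ≤ (R : ℝ) ^ 2 :=
      ((pow_le_pow_left₀ (by positivity) h3 K).trans hK).trans (by nlinarith)
    exact_mod_cast h4
  · have := Real.log_le_log (by positivity) hR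
    rw [Real.log_rpow hN] at this
    linarith

theorem sqrt_mul_primorial_le {N : ℕ} (hN : 1 ≤ N) :
    Real.sqrt N * primorial ⌊Real.log N / 3⌋₊ ≤ N := by
  have hN1 : (1 : ℝ) ≤ N := by exact_mod_cast hN
  have hlog : 0 ≤ Real.log N := Real.log_nonneg hN1
  have h1 : (primorial ⌊Real.log N / 3⌋₊ : ℝ) ≤ (4 : ℝ) ^ ⌊Real.log N / 3⌋₊ := by
    exact_mod_cast primorial_le_four_pow _
  have h2 : (4 : ℝ) ^ ⌊Real.log N / 3⌋₊ ≤ Real.sqrt N := by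
    rw [Real.le_sqrt (by positivity) (by positivity), ← pow_mul, mul_comm, pow_mul,
      ← Real.log_le_log_iff (by positivity) (by positivity), Real.log_pow]
    have h3 : Real.log (4 ^ 2) ≤ 3 := by
      have : Real.log (4 ^ 2) = 4 * Real.log 2 := by
        rw [show (4 : ℝ) ^ 2 = 2 ^ 4 by norm_num, Real.log_pow]; norm_num
      have := Real.log_two_lt_d9
      linarith
    have h4 := Nat.floor_le (div_nonneg hlog (by norm_num : (0 : ℝ) ≤ 3))
    calc _ ≤ Real.log N / 3 * 3 := mul_le_mul h4 h3 (Real.log_nonneg (by norm_num)) (by positivity)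
      _ = _ := by ring
  calc _ ≤ Real.sqrt N * Real.sqrt N := mul_le_mul_of_nonneg_left (h1.trans h2) (by positivity)
    _ = N := Real.mul_self_sqrt (by positivity)

theorem floor_rpow_pow_le_sqrt (N : ℕ) :
    (⌊(N : ℝ) ^ (1 / 40 : ℝ)⌋₊ : ℝ) ^ 20 ≤ Real.sqrt N := by
  refine (pow_le_pow_left₀ (by positivity) (Nat.floor_le (by positivity)) 20).trans (le_of_eq ?_)
  rw [← Real.rpow_natCast, ← Real.rpow_mul (by positivity), Real.sqrt_eq_rpow]
  norm_num

end

/-- **Restriction estimate (Lemma 2 / Green–Tao restriction for a sieve majorant).**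
For every `p > 2` there is a constant `C_p` such that for all sufficiently large `N`,
with `z = (log N)/3`, `M = ∏_{q ≤ z, q prime} q`, `N'` the least prime exceeding
`⌈2N/M⌉`, `b` coprime to `M`, `A₀ ⊆ ℤ/N'ℤ` the reduction of a subset of
`{n ∈ [1, N'] : b + nM prime}` and `a = (log N/(N' log z))·1_{A₀}`, one has
`∑_m |â(m)|^p ≤ C_p`. -/
theorem restriction_estimate (p : ℝ) (hp : 2 < p) :
    ∃ C : ℝ, ∃ N₀ : ℕ, ∀ N : ℕ, N₀ ≤ N →
      ∀ z : ℝ, z = Real.log N / 3 →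
        ∀ M : ℕ, M = ∏ q ∈ Finset.filter Nat.Prime (Finset.range (⌊z⌋₊ + 1)), q →
          ∀ (N' : ℕ) [NeZero N'], Nat.Prime N' →
            ⌈(2 * N : ℝ) / M⌉₊ < N' →
            (∀ q : ℕ, Nat.Prime q → ⌈(2 * N : ℝ) / M⌉₊ < q → N' ≤ q) →
            ∀ b : ℤ, Int.gcd b M = 1 →
              ∀ A₀ : Finset (ZMod N'),
                (∀ x ∈ A₀, ∃ n : ℕ, 1 ≤ n ∧ n ≤ N' ∧ Prime ((b + n * M : ℤ)) ∧
                  (n : ZMod N') = x) →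
                ∀ a : ZMod N' → ℝ,
                  (a = fun n =>
                    if n ∈ A₀ then Real.log N / (N' * Real.log z) else 0) →
                  ∑ m : ZMod N', ‖dft (fun n => (a n : ℂ)) m‖ ^ p ≤ C := by
  obtain ⟨c, hc0, hc⟩ := exists_log_le_selbergSum
  obtain ⟨K, hK⟩ := exists_nat_ge (4 / (p - 2))
  have hp2 : 0 < p - 2 := by linarith
  have hK4 : 4 ≤ K * (p - 2) := by rwa [div_le_iff₀ hp2] at hK
  have hK0 : (0 : ℝ) < K := lt_of_lt_of_le (by positivity) hK
  set B : ℝ := 320 * c * K with hBdef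
  have hB : 0 < B := by positivity
  obtain ⟨N₀, hN₀⟩ := Filter.eventually_atTop.1 (eventually_sieve_parameters K)
  refine ⟨4 * (2 * B ^ 2) * B ^ (p - 2) / (1 - (1 / 2 : ℝ) ^ (p - 2))
    + (2 * B ^ 2) ^ ((p - 2) / 2) * (6 * B), N₀, ?_⟩
  rintro N hN z hz M hM N' _ _ hN' _ b _ A₀ hA₀ a rfl
  obtain ⟨h9, hwR, hR, hlogR⟩ := hN₀ N hN
  rw [← hz] at hwR
  have hN1 : 1 ≤ N := by
    by_contra h
    obtain rfl : N = 0 := by omega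
    norm_num at h9
  have hMp : M = primorial ⌊z⌋₊ := hM
  have hz3 : 3 ≤ z := by linarith
  have hfz : (⌊z⌋₊ : ℝ) ≤ z := Nat.floor_le (by linarith)
  have hzf := Nat.lt_floor_add_one z
  have hRN : ⌊(N : ℝ) ^ (1 / 40 : ℝ)⌋₊ ^ 13 ≤ N' := by
    have h1 := floor_rpow_pow_le_sqrt N
    have h2 := sqrt_mul_primorial_le hN1
    rw [← hz, ← hMp] at h2
    have hMpos : (0 : ℝ) < M := by rw [hMp]; exact_mod_cast primorial_pos _
    have h3 : Real.sqrt N ≤ 2 * N / M := by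
      rw [le_div_iff₀ hMpos]
      linarith [(Nat.cast_nonneg N : (0 : ℝ) ≤ N)]
    have h4 : (2 * N : ℝ) / M ≤ N' := (Nat.le_ceil _).trans (by exact_mod_cast hN'.le)
    have h5 : (⌊(N : ℝ) ^ (1 / 40 : ℝ)⌋₊ : ℝ) ^ 13 ≤ (⌊(N : ℝ) ^ (1 / 40 : ℝ)⌋₊ : ℝ) ^ 20 :=
      pow_le_pow_right₀ (by exact_mod_cast (by omega : 1 ≤ ⌊(N : ℝ) ^ (1 / 40 : ℝ)⌋₊)) (by norm_num)
    exact_mod_cast h5.trans (h1.trans (h3.trans h4))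
  set R := ⌊(N : ℝ) ^ (1 / 40 : ℝ)⌋₊
  set y := ⌊z⌋₊ with hy
  have hy3 : 3 ≤ y := Nat.le_floor (by exact_mod_cast hz3)
  have hy0 : (0 : ℝ) < y := by positivity
  have hKne : K ≠ 0 := by exact_mod_cast hK0.ne'
  have hyw : y ≤ y ^ K := Nat.le_self_pow hKne y
  have hlogz : 1 ≤ Real.log z := by
    rw [Real.le_log_iff_exp_le (by linarith)]
    linarith [Real.exp_one_lt_d9]
  have hN'0 : (0 : ℝ) < N' := Nat.cast_pos.2 (NeZero.pos N')
  set s : ℝ := Real.log N / (N' * Real.log z) with hs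
  have hsN : s * N' = Real.log N / Real.log z := by
    rw [hs]
    field_simp
  have hsB : 4 * (s * N') ≤ B * selbergSum (y ^ K) R := by
    have h1 := hc (y ^ K) R (by omega) (by omega)
    have h2 : Real.log ((y ^ K : ℕ) : ℝ) ≤ K * Real.log z := by
      rw [Nat.cast_pow, Real.log_pow]
      exact mul_le_mul_of_nonneg_left (Real.log_le_log hy0 hfz) hK0.le
    have hJ0 : 0 ≤ selbergSum (y ^ K) R := zero_le_one.trans (one_le_selbergSum (by omega))
    have h3 : Real.log R ≤ c * (K * Real.log z) * selbergSum (y ^ K) R := h1.trans (by gcongr)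
    rw [hsN, ← mul_div_assoc, div_le_iff₀ (by linarith)]
    calc 4 * Real.log N ≤ 4 * (80 * (c * (K * Real.log z) * selbergSum (y ^ K) R)) := by linarith
      _ = _ := by rw [hBdef]; ring
  have hs0 : 0 ≤ s := by positivity
  refine (sum_norm_dft_rpow_le_of_prime hp (hy3.trans hyw |>.trans' (by norm_num)) hR hwR hRN
    (hMp ▸ primorial_pos _) ?_ hs0 hB hsB b fun x hx => ?_).trans ?_
  · intro l hl hd
    rw [hM, hl.prime.dvd_finsetProd_iff] at hd
    obtain ⟨q, hq, hlq⟩ := hd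
    rw [Finset.mem_filter, Finset.mem_range] at hq
    rw [(Nat.prime_dvd_prime_iff_eq hl hq.2).1 hlq]
    omega
  · obtain ⟨n, _, hn, hnp, hnx⟩ := hA₀ x hx
    exact ⟨n, hn, hnp, hnx⟩
  · refine add_le_add le_rfl ?_
    have h1 : (1 / Real.sqrt ((y ^ K : ℕ) : ℝ)) ^ ((p - 2) / 2) ≤ 1 / y := by
      have h2 : Real.sqrt ((y ^ K : ℕ) : ℝ) ^ ((p - 2) / 2) = (y : ℝ) ^ (K * (p - 2) / 4) := by
        rw [Real.sqrt_eq_rpow, Nat.cast_pow, ← Real.rpow_natCast, ← Real.rpow_mul hy0.le,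
          ← Real.rpow_mul hy0.le]
        ring_nf
      rw [Real.div_rpow (by norm_num) (by positivity), Real.one_rpow, h2]
      refine one_div_le_one_div_of_le hy0 ?_
      exact Real.self_le_rpow_of_one_le (by exact_mod_cast (by omega : 1 ≤ y)) (by linarith)
    have h3 : N' * s ≤ 6 * y := by
      rw [mul_comm, hsN, div_le_iff₀ (by linarith)]
      have hy3' : (3 : ℝ) ≤ y := by exact_mod_cast hy3
      nlinarith
    rw [Real.mul_rpow (by positivity) (by positivity), mul_assoc]
    refine mul_le_mul_of_nonneg_left ?_ (by positivity)
    calc _ ≤ 1 / (y : ℝ) * (6 * y * B) := by gcongr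
      _ = 6 * B := by field_simp
end

section
/- There is an absolute constant C such that the following holds for all sufficiently large N. Set z = (log N)/3, M = ∏_{q ≤ z, q prime} q, let N' be the least prime larger than ⌈2N/M⌉, let b be an integer with gcd(b, M) = 1, and define λ: ℤ → ℝ by λ(n) = log N/(N' log z) if 1 ≤ n ≤ N' and b + nM is prime, and λ(n) = 0 otherwise. Then for all integers m₁, m₂: if m₁ = m₂, ∑_{n ∈ ℤ} λ(n+m₁)λ(n+m₂) ≤ C·log N/(N' log z); and if m₁ ≠ m₂, ∑_{n ∈ ℤ} λ(n+m₁)λ(n+m₂) ≤ (C/N')·∏_{p prime, p > z, p | (m₁−m₂)} p/(p−1). -/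
open scoped Classical

/-- Chebyshev-type upper bound in Mertens' first theorem. -/
lemma sum_primesLE_log_div_le {n : ℕ} (hn : 1 ≤ n) :
    ∑ p ∈ n.primesLE, Real.log p / p ≤ Real.log n + Real.log 4 := by
  have hn0 : (0 : ℝ) < n := by exact_mod_cast hn
  have hdvd : ∏ p ∈ n.primesLE, p ^ (n / p) ∣ n.factorial := by
    refine Finset.prod_dvd_of_isRelPrime (fun p hp q hq hpq => ?_) (fun p hp => ?_)
    · exact Nat.coprime_iff_isRelPrime.1 (Nat.coprime_pow_primes _ _
        (Nat.prime_of_mem_primesBelow hp) (Nat.prime_of_mem_primesBelow hq) hpq)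
    · have hp' := Nat.prime_of_mem_primesBelow hp
      rw [hp'.pow_dvd_iff_le_factorization n.factorial_ne_zero,
        Nat.factorization_factorial hp' (b := Nat.log p n + 2) (by omega)]
      calc n / p = n / p ^ 1 := by simp
        _ ≤ _ := Finset.single_le_sum (f := fun i => n / p ^ i) (fun _ _ => Nat.zero_le _)
          (by simp)
  have hle : ∏ p ∈ n.primesLE, p ^ (n / p) ≤ n ^ n :=
    (Nat.le_of_dvd n.factorial_pos hdvd).trans n.factorial_le_pow
  have hlog : ∑ p ∈ n.primesLE, ((n / p : ℕ) : ℝ) * Real.log p ≤ n * Real.log n := by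
    have h := Real.log_le_log (by
      exact_mod_cast Finset.prod_pos fun p hp => pow_pos (Nat.prime_of_mem_primesBelow hp).pos _)
      (Nat.cast_le (α := ℝ).2 hle)
    rw [Nat.cast_prod, Real.log_prod] at h
    · simpa using h
    · intro p hp
      have := (Nat.prime_of_mem_primesBelow hp).pos
      positivity
  have htheta : ∑ p ∈ n.primesLE, Real.log p ≤ Real.log 4 * n := by
    rw [← Chebyshev.theta_eq_sum_primesLE_log]
    exact Chebyshev.theta_le_log4_mul_x hn0.le
  have hterm : ∑ p ∈ n.primesLE, (n * (Real.log p / p) - Real.log p) ≤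
      ∑ p ∈ n.primesLE, ((n / p : ℕ) : ℝ) * Real.log p := by
    refine Finset.sum_le_sum fun p hp => ?_
    have hp' := Nat.prime_of_mem_primesBelow hp
    have h1 : (n : ℝ) / p ≤ (n / p : ℕ) + 1 := (Nat.lt_floor_add_one ((n : ℝ) / p)).le.trans (by
      rw [Nat.floor_div_eq_div])
    have h2 : 0 ≤ Real.log p := Real.log_natCast_nonneg p
    calc n * (Real.log p / p) - Real.log p = (n / p - 1) * Real.log p := by ring
      _ ≤ _ := by gcongr; linarith
  rw [Finset.sum_sub_distrib, ← Finset.mul_sum] at hterm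
  have : n * ∑ p ∈ n.primesLE, Real.log p / p ≤ n * (Real.log n + Real.log 4) := by linarith
  exact le_of_mul_le_mul_left this hn0

/-- The completely multiplicative function `n ↦ n ^ (-s)`. -/
noncomputable def natRpowNegHom (s : ℝ) : ℕ →* ℝ where
  toFun n := (n : ℝ) ^ (-s)
  map_one' := by simp
  map_mul' m n := by
    push_cast
    exact Real.mul_rpow (Nat.cast_nonneg _) (Nat.cast_nonneg _)

lemma natRpowNegHom_norm_lt_one {s : ℝ} (hs : 0 < s) {p : ℕ} (hp : p.Prime) :
    ‖natRpowNegHom s p‖ < 1 := by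
  rw [Real.norm_of_nonneg (by simp only [natRpowNegHom, MonoidHom.coe_mk, OneHom.coe_mk]; positivity)]
  exact Real.rpow_lt_one_of_one_lt_of_neg (by exact_mod_cast hp.one_lt) (by linarith)

lemma log_add_one_le_prod_primesLE (n : ℕ) :
    Real.log (n + 1) ≤ ∏ p ∈ n.primesLE, (p : ℝ) / (p - 1) := by
  obtain ⟨h1, h2⟩ := EulerProduct.summable_and_hasSum_smoothNumbers_prod_primesBelow_geometric
    (f := natRpowNegHom 1) (natRpowNegHom_norm_lt_one one_pos) (n + 1)
  have hprod : ∏ p ∈ n.primesLE, (p : ℝ) / (p - 1) =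
      ∏ p ∈ (n + 1).primesBelow, (1 - natRpowNegHom 1 p)⁻¹ := by
    refine Finset.prod_congr rfl fun p hp => ?_
    have hp' : (1 : ℝ) < p := by exact_mod_cast (Nat.prime_of_mem_primesBelow hp).one_lt
    simp only [natRpowNegHom, MonoidHom.coe_mk, OneHom.coe_mk, Real.rpow_neg_one]
    have : (p : ℝ) - 1 ≠ 0 := by linarith
    field_simp
  rw [hprod]
  have hmem : ∀ m ∈ Finset.Icc 1 n, m ∈ Nat.smoothNumbers (n + 1) := fun m hm => by
    rw [Finset.mem_Icc] at hm
    exact Nat.mem_smoothNumbers_of_lt (by omega) (by omega)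
  calc Real.log (n + 1) = Real.log ((n + 1 : ℕ) : ℝ) := by push_cast; rfl
    _ ≤ (harmonic n : ℝ) := by exact_mod_cast log_add_one_le_harmonic n
    _ = ∑ m ∈ Finset.Icc 1 n, natRpowNegHom 1 m := by
      rw [harmonic_eq_sum_Icc]
      push_cast
      simp [natRpowNegHom, Real.rpow_neg_one]
    _ = ∑ m ∈ (Finset.Icc 1 n).subtype (· ∈ Nat.smoothNumbers (n + 1)), natRpowNegHom 1 m := by
      rw [Finset.sum_subtype_eq_sum_filter, Finset.filter_true_of_mem hmem]
    _ ≤ _ := sum_le_hasSum _ (fun m _ => by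
      simp only [natRpowNegHom, MonoidHom.coe_mk, OneHom.coe_mk]; positivity) h2

lemma prod_primesLE_rpow_le (n : ℕ) {s : ℝ} (hs : 1 < s) :
    ∏ p ∈ n.primesLE, (1 - (p : ℝ) ^ (-s))⁻¹ ≤ 1 + 1 / (s - 1) := by
  have hsum : Summable (natRpowNegHom s) := Real.summable_nat_rpow.2 (by linarith)
  have hnn : ∀ m, 0 ≤ natRpowNegHom s m := fun m => by
    simp only [natRpowNegHom, MonoidHom.coe_mk, OneHom.coe_mk]; positivity
  have h := EulerProduct.prod_primesBelow_geometric_eq_tsum_smoothNumbers hsum (n + 1)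
  have hz : ∑' m : ℕ, natRpowNegHom s m = ∑' m : ℕ, 1 / (m + 1 : ℝ) ^ s := by
    rw [hsum.tsum_eq_zero_add]
    have h0 : natRpowNegHom s 0 = 0 := by
      simp only [natRpowNegHom, MonoidHom.coe_mk, OneHom.coe_mk, Nat.cast_zero]
      exact Real.zero_rpow (by linarith)
    rw [h0, zero_add]
    refine tsum_congr fun m => ?_
    simp only [natRpowNegHom, MonoidHom.coe_mk, OneHom.coe_mk]
    rw [Real.rpow_neg (by positivity)]
    push_cast
    simp
  have hnonneg : 0 ≤ ZetaAsymptotics.termTSum s :=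
    tsum_nonneg fun m => ZetaAsymptotics.term_nonneg (m + 1) s
  have haux := ZetaAsymptotics.zeta_limit_aux1 hs
  calc _ = ∑' m : Nat.smoothNumbers (n + 1), natRpowNegHom s m := h
    _ ≤ ∑' m : ℕ, natRpowNegHom s m := hsum.tsum_subtype_le _ _ hnn
    _ ≤ _ := by rw [hz]; nlinarith

lemma prod_primesLE_le {n : ℕ} (hn : 4 ≤ n) :
    ∏ p ∈ n.primesLE, (p : ℝ) / (p - 1) ≤ 2 * Real.exp 4 * Real.log n := by
  have hn4 : (4 : ℝ) ≤ n := by exact_mod_cast hn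
  have hlog4 : Real.log 4 ≤ Real.log n := Real.log_le_log (by norm_num) hn4
  have hlog1 : 1 ≤ Real.log 4 := by
    rw [show (4 : ℝ) = 2 ^ 2 by norm_num, Real.log_pow]
    have := Real.log_two_gt_d9
    push_cast; linarith
  set L := Real.log n with hL
  have hL0 : 0 < L := by linarith
  have hbound := prod_primesLE_rpow_le n (s := 1 + 1 / L) (by linarith [one_div_pos.2 hL0])
  have hterm : ∀ p ∈ n.primesLE, (p : ℝ) / (p - 1) ≤
      (1 - (p : ℝ) ^ (-(1 + 1 / L)))⁻¹ * Real.exp (2 / L * (Real.log p / p)) := by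
    intro p hp
    have hp' := Nat.prime_of_mem_primesBelow hp
    have hp2 : (2 : ℝ) ≤ p := by exact_mod_cast hp'.two_le
    have hlt := natRpowNegHom_norm_lt_one (s := 1 + 1 / L) (by positivity) hp'
    have hpos : 0 < 1 - (p : ℝ) ^ (-(1 + 1 / L)) := by
      have := (le_abs_self _).trans_lt hlt
      simp only [natRpowNegHom, MonoidHom.coe_mk, OneHom.coe_mk] at this
      linarith
    rw [inv_mul_eq_div, le_div_iff₀ hpos]
    have hpow : (p : ℝ) ^ (-(1 + 1 / L)) = (p : ℝ)⁻¹ * Real.exp (-(Real.log p / L)) := by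
      rw [neg_add, Real.rpow_add (by linarith), Real.rpow_neg_one,
        Real.rpow_def_of_pos (by linarith) (-(1 / L))]
      congr 2
      ring
    have hexp := Real.add_one_le_exp (-(Real.log p / L))
    have hlp : 0 ≤ Real.log p / L := div_nonneg (Real.log_natCast_nonneg p) hL0.le
    calc (p : ℝ) / (p - 1) * (1 - (p : ℝ) ^ (-(1 + 1 / L)))
        = 1 + (1 - Real.exp (-(Real.log p / L))) / (p - 1) := by
          rw [hpow]
          have : (p : ℝ) - 1 ≠ 0 := by linarith
          field_simp
          ring
      _ ≤ 1 + (Real.log p / L) / (p / 2) := by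
          gcongr
          · linarith
          · linarith
      _ = 2 / L * (Real.log p / p) + 1 := by field_simp; ring
      _ ≤ _ := Real.add_one_le_exp _
  calc ∏ p ∈ n.primesLE, (p : ℝ) / (p - 1)
      ≤ ∏ p ∈ n.primesLE, ((1 - (p : ℝ) ^ (-(1 + 1 / L)))⁻¹ *
          Real.exp (2 / L * (Real.log p / p))) := by
        refine Finset.prod_le_prod (fun p hp => ?_) hterm
        have hp2 : (2 : ℝ) ≤ p := by exact_mod_cast (Nat.prime_of_mem_primesBelow hp).two_le
        exact div_nonneg (by linarith) (by linarith)
    _ = (∏ p ∈ n.primesLE, (1 - (p : ℝ) ^ (-(1 + 1 / L)))⁻¹) *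
          Real.exp (2 / L * ∑ p ∈ n.primesLE, Real.log p / p) := by
        rw [Finset.prod_mul_distrib, ← Real.exp_sum, Finset.mul_sum]
    _ ≤ (1 + 1 / (1 + 1 / L - 1)) * Real.exp 4 := by
        have h0 : 0 ≤ 1 + 1 / (1 + 1 / L - 1) := by simp; linarith
        refine mul_le_mul hbound (Real.exp_le_exp.2 ?_) (Real.exp_pos _).le h0
        calc 2 / L * ∑ p ∈ n.primesLE, Real.log p / p ≤ 2 / L * (L + L) := by
              gcongr
              exact (sum_primesLE_log_div_le (by omega)).trans (by linarith)
          _ = 4 := by field_simp; norm_num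
    _ ≤ _ := by
        have : 1 / (1 + 1 / L - 1) = L := by simp
        rw [this]
        nlinarith [Real.exp_pos 4]

lemma sum_range_mul_of_coprime {a b : ℕ} (ha : a ≠ 0) (hb : b ≠ 0) (hab : a.Coprime b)
    {f g : ℕ → ℝ} (hf : Function.Periodic f a) (hg : Function.Periodic g b) :
    ∑ n ∈ Finset.range (a * b), f n * g n =
      (∑ n ∈ Finset.range a, f n) * ∑ n ∈ Finset.range b, g n := by
  rw [Finset.sum_mul_sum, ← Finset.sum_product']
  refine Finset.sum_nbij' (fun n => (n % a, n % b))
    (fun x => (Nat.chineseRemainder hab x.1 x.2 : ℕ)) ?_ ?_ ?_ ?_ ?_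
  · intro n _
    simp [Nat.mod_lt _ (Nat.pos_of_ne_zero ha), Nat.mod_lt _ (Nat.pos_of_ne_zero hb)]
  · intro x _
    exact Finset.mem_range.2 (Nat.chineseRemainder_lt_mul hab _ _ ha hb)
  · intro n hn
    have h := (Nat.chineseRemainder hab (n % a) (n % b)).2
    refine Nat.ModEq.eq_of_lt_of_lt ?_ (Nat.chineseRemainder_lt_mul hab _ _ ha hb)
      (Finset.mem_range.1 hn)
    exact (Nat.modEq_and_modEq_iff_modEq_mul hab).1
      ⟨h.1.trans (Nat.mod_modEq _ _), h.2.trans (Nat.mod_modEq _ _)⟩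
  · rintro ⟨x, y⟩ hxy
    simp only [Finset.mem_product, Finset.mem_range] at hxy
    have h := (Nat.chineseRemainder hab x y).2
    ext
    · exact Eq.trans h.1 (Nat.mod_eq_of_lt hxy.1)
    · exact Eq.trans h.2 (Nat.mod_eq_of_lt hxy.2)
  · intro n _
    simp only [hf.map_mod_nat, hg.map_mod_nat]

lemma periodic_prod_primes {U : Finset ℕ} {F : ℕ → ℕ → ℝ}
    (hF : ∀ p ∈ U, Function.Periodic (F p) p) :
    Function.Periodic (fun n => ∏ p ∈ U, F p n) (∏ p ∈ U, p) := by
  intro n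
  refine Finset.prod_congr rfl fun p hp => ?_
  obtain ⟨k, hk⟩ := Finset.dvd_prod_of_mem (fun p => p) hp
  rw [hk, mul_comm]
  exact (hF p hp).nat_mul k n

lemma sum_range_prod_primes {U : Finset ℕ} (hU : ∀ p ∈ U, p.Prime) {F : ℕ → ℕ → ℝ}
    (hF : ∀ p ∈ U, Function.Periodic (F p) p) :
    ∑ n ∈ Finset.range (∏ p ∈ U, p), ∏ p ∈ U, F p n =
      ∏ p ∈ U, ∑ n ∈ Finset.range p, F p n := by
  induction U using Finset.induction_on with
  | empty => simp
  | insert q U hq ih =>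
    have hU' : ∀ p ∈ U, p.Prime := fun p hp => hU p (Finset.mem_insert_of_mem hp)
    have hF' : ∀ p ∈ U, Function.Periodic (F p) p := fun p hp => hF p (Finset.mem_insert_of_mem hp)
    have hqp := hU q (Finset.mem_insert_self _ _)
    simp only [Finset.prod_insert hq]
    rw [← ih hU' hF', sum_range_mul_of_coprime hqp.ne_zero
      (Finset.prod_ne_zero_iff.2 fun p hp => (hU' p hp).ne_zero) ?_
      (hF q (Finset.mem_insert_self _ _)) (periodic_prod_primes hF')]
    refine Nat.Coprime.prod_right fun p hp => (Nat.coprime_primes hqp (hU' p hp)).2 ?_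
    rintro rfl
    exact hq hp

lemma sum_range_le_of_periodic {Q : ℕ} (hQ : 0 < Q) {f : ℕ → ℝ} (hf : Function.Periodic f Q)
    (hf1 : ∀ n, |f n| ≤ 1) (L : ℕ) :
    ∑ n ∈ Finset.range L, f n ≤ L * ((∑ n ∈ Finset.range Q, f n) / Q) + 2 * Q := by
  set S := ∑ n ∈ Finset.range Q, f n with hS
  have hQ' : (0 : ℝ) < Q := by exact_mod_cast hQ
  have habs : ∀ r : ℕ, |∑ n ∈ Finset.range r, f n| ≤ r := fun r =>
    (Finset.abs_sum_le_sum_abs _ _).trans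
      ((Finset.sum_le_sum fun n _ => hf1 n).trans (by simp))
  have hblock : ∀ k r : ℕ, ∑ n ∈ Finset.range (k * Q + r), f n =
      k * S + ∑ n ∈ Finset.range r, f n := by
    intro k r
    induction k with
    | zero => simp
    | succ k ih =>
      rw [show (k + 1) * Q + r = Q + (k * Q + r) by ring, Finset.sum_range_add]
      have : ∀ x, f (Q + x) = f x := fun x => by rw [add_comm]; exact hf x
      simp only [this, ih, hS]
      push_cast
      ring
  have hr : L % Q < Q := Nat.mod_lt _ hQ
  have hL : L / Q * Q + L % Q = L := Nat.div_add_mod' L Q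
  have hr' : ((L % Q : ℕ) : ℝ) ≤ Q := by exact_mod_cast hr.le
  have hLr : (L : ℝ) = (L / Q : ℕ) * Q + (L % Q : ℕ) := by exact_mod_cast hL.symm
  have h1 := (abs_le.1 (habs (L % Q))).2
  have h2 : -1 ≤ S / Q := by
    rw [le_div_iff₀ hQ']
    linarith [(abs_le.1 (habs Q)).1]
  have h3 := hblock (L / Q) (L % Q)
  rw [hL] at h3
  rw [h3]
  have h4 : L * (S / Q) = (L / Q : ℕ) * S + (L % Q : ℕ) * (S / Q) := by
    rw [hLr]
    field_simp
  have h5 : (0 : ℝ) ≤ (L % Q : ℕ) := Nat.cast_nonneg _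
  rw [h4]
  nlinarith

/-- The mean-zero local weight at `p`, equal to `-1` on the `ρ` sifted residue classes
modulo `p` and constant on the others. -/
noncomputable def sieveWeight (bad : ℕ → ℕ → Prop) (ρ : ℕ → ℕ) (p n : ℕ) : ℝ :=
  if bad p n then -1 else (ρ p : ℝ) / (p - ρ p)

section SieveWeight

variable {bad : ℕ → ℕ → Prop} {ρ : ℕ → ℕ} {p : ℕ}

lemma sieveDensity_nonneg (h2 : 2 * ρ p ≤ p) : 0 ≤ (ρ p : ℝ) / (p - ρ p) := by
  have h : (2 * ρ p : ℝ) ≤ p := by exact_mod_cast h2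
  have : (0 : ℝ) ≤ ρ p := Nat.cast_nonneg _
  exact div_nonneg this (by linarith)

lemma sieveDensity_le_one (h2 : 2 * ρ p ≤ p) : (ρ p : ℝ) / (p - ρ p) ≤ 1 := by
  have h : (2 * ρ p : ℝ) ≤ p := by exact_mod_cast h2
  have : (0 : ℝ) ≤ ρ p := Nat.cast_nonneg _
  exact div_le_one_of_le₀ (by linarith) (by linarith)

lemma abs_sieveWeight_le_one (h2 : 2 * ρ p ≤ p) (n : ℕ) : |sieveWeight bad ρ p n| ≤ 1 := by
  unfold sieveWeight
  split_ifs
  · simp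
  · rw [abs_of_nonneg (sieveDensity_nonneg h2)]
    exact sieveDensity_le_one h2

lemma sieveWeight_periodic (hbad : ∀ n, bad p (n + p) ↔ bad p n) :
    Function.Periodic (sieveWeight bad ρ p) p := fun n => by
  simp [sieveWeight, hbad]

lemma card_unsifted_residues (hρ : ((Finset.range p).filter (bad p)).card = ρ p) :
    (((Finset.range p).filter (fun n => ¬ bad p n)).card : ℝ) = p - ρ p := by
  have h := Finset.card_filter_add_card_filter_not (s := Finset.range p) (bad p)
  rw [hρ, Finset.card_range] at h
  rw [eq_sub_iff_add_eq']
  exact_mod_cast h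

lemma sum_range_sieveWeight (hp : p.Prime) (h2 : 2 * ρ p ≤ p)
    (hρ : ((Finset.range p).filter (bad p)).card = ρ p) :
    ∑ n ∈ Finset.range p, sieveWeight bad ρ p n = 0 := by
  have h : (2 * ρ p : ℝ) ≤ p := by exact_mod_cast h2
  have hp0 : (0 : ℝ) < p := by exact_mod_cast hp.pos
  have hc := card_unsifted_residues hρ
  have hne : (p : ℝ) - ρ p ≠ 0 := by linarith
  simp only [sieveWeight, Finset.sum_ite, Finset.sum_const, nsmul_eq_mul, hρ, hc]
  field_simp
  ring

lemma sum_range_sieveWeight_sq (hp : p.Prime) (h2 : 2 * ρ p ≤ p)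
    (hρ : ((Finset.range p).filter (bad p)).card = ρ p) :
    ∑ n ∈ Finset.range p, sieveWeight bad ρ p n * sieveWeight bad ρ p n =
      p * ((ρ p : ℝ) / (p - ρ p)) := by
  have h : (2 * ρ p : ℝ) ≤ p := by exact_mod_cast h2
  have hp0 : (0 : ℝ) < p := by exact_mod_cast hp.pos
  have hc := card_unsifted_residues hρ
  have hne : (p : ℝ) - ρ p ≠ 0 := by linarith
  have hsq : ∀ n, sieveWeight bad ρ p n * sieveWeight bad ρ p n =
      if bad p n then 1 else ((ρ p : ℝ) / (p - ρ p)) ^ 2 := fun n => by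
    unfold sieveWeight
    split_ifs <;> ring
  simp only [hsq, Finset.sum_ite, Finset.sum_const, nsmul_eq_mul, hρ, hc]
  field_simp
  ring

end SieveWeight

/-- Quasi-orthogonality of the products of local weights. -/
lemma sum_prod_sieveWeight_le {P : Finset ℕ} (hP : ∀ p ∈ P, p.Prime) {bad : ℕ → ℕ → Prop}
    {ρ : ℕ → ℕ} (hbad : ∀ p ∈ P, ∀ n, bad p (n + p) ↔ bad p n)
    (hρ : ∀ p ∈ P, ((Finset.range p).filter (bad p)).card = ρ p)
    (h2 : ∀ p ∈ P, 2 * ρ p ≤ p) {S T : Finset ℕ} (hS : S ⊆ P) (hT : T ⊆ P) (L : ℕ) :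
    ∑ n ∈ Finset.range L,
        (∏ p ∈ S, sieveWeight bad ρ p n) * ∏ p ∈ T, sieveWeight bad ρ p n ≤
      (if S = T then L * ∏ p ∈ S, (ρ p : ℝ) / (p - ρ p) else 0) +
        2 * ((∏ p ∈ S, (p : ℝ)) * ∏ p ∈ T, (p : ℝ)) := by
  set F : ℕ → ℕ → ℝ := fun p n =>
    (if p ∈ S then sieveWeight bad ρ p n else 1) * (if p ∈ T then sieveWeight bad ρ p n else 1)
    with hF
  have hST : S ∪ T ⊆ P := Finset.union_subset hS hT
  have hprime : ∀ p ∈ S ∪ T, p.Prime := fun p hp => hP p (hST hp)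
  have hper : ∀ p ∈ S ∪ T, Function.Periodic (F p) p := fun p hp n => by
    simp only [hF, sieveWeight_periodic (ρ := ρ) (hbad p (hST hp)) n]
  have hprod : ∀ n, (∏ p ∈ S, sieveWeight bad ρ p n) * ∏ p ∈ T, sieveWeight bad ρ p n =
      ∏ p ∈ S ∪ T, F p n := fun n => by
    rw [hF, Finset.prod_mul_distrib, Finset.prod_ite_mem, Finset.prod_ite_mem,
      Finset.inter_eq_right.2 Finset.subset_union_left,
      Finset.inter_eq_right.2 Finset.subset_union_right]
  have hone : ∀ n, |∏ p ∈ S ∪ T, F p n| ≤ 1 := fun n => by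
    rw [Finset.abs_prod]
    refine Finset.prod_le_one (fun _ _ => abs_nonneg _) fun p hp => ?_
    have h1 := abs_sieveWeight_le_one (bad := bad) (h2 p (hST hp)) n
    rw [hF, abs_mul]
    refine mul_le_one₀ ?_ (abs_nonneg _) ?_ <;> split_ifs <;> simp [h1]
  have hQ : 0 < ∏ p ∈ S ∪ T, p := Finset.prod_pos fun p hp => (hprime p hp).pos
  have hmain := sum_range_le_of_periodic hQ (periodic_prod_primes hper) hone L
  rw [sum_range_prod_primes hprime hper] at hmain
  simp only [hprod]
  refine hmain.trans (add_le_add ?_ ?_)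
  · split_ifs with h
    · subst h
      have : ∏ p ∈ S ∪ S, ∑ n ∈ Finset.range p, F p n =
          (∏ p ∈ S, (p : ℝ)) * ∏ p ∈ S, (ρ p : ℝ) / (p - ρ p) := by
        rw [Finset.union_self, ← Finset.prod_mul_distrib]
        refine Finset.prod_congr rfl fun p hp => ?_
        simp only [hF, hp, if_true]
        exact sum_range_sieveWeight_sq (hP p (hS hp)) (h2 p (hS hp)) (hρ p (hS hp))
      rw [this, Finset.union_self, Nat.cast_prod, mul_div_cancel_left₀]
      exact Finset.prod_ne_zero_iff.2 fun p hp => by exact_mod_cast (hP p (hS hp)).ne_zero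
    · have : ∏ p ∈ S ∪ T, ∑ n ∈ Finset.range p, F p n = 0 := by
        obtain ⟨p, hp⟩ : ∃ p, ¬ (p ∈ S ↔ p ∈ T) := by
          by_contra! hc
          exact h (Finset.ext hc)
        have hpU : p ∈ S ∪ T := by rw [Finset.mem_union]; tauto
        refine Finset.prod_eq_zero hpU ?_
        rw [← sum_range_sieveWeight (hprime p hpU) (h2 p (hST hpU)) (hρ p (hST hpU))]
        refine Finset.sum_congr rfl fun n _ => ?_
        simp only [hF]
        by_cases h1 : p ∈ S <;> by_cases h3 : p ∈ T <;> simp_all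
      simp [this]
  · have : ∏ p ∈ S ∪ T, p ≤ (∏ p ∈ S, p) * ∏ p ∈ T, p := by
      rw [← Finset.prod_union_inter]
      exact Nat.le_mul_of_pos_right _ (Finset.prod_pos fun p hp =>
        (hP p (hS (Finset.inter_subset_left hp))).pos)
    have : ((∏ p ∈ S ∪ T, p : ℕ) : ℝ) ≤ (∏ p ∈ S, (p : ℝ)) * ∏ p ∈ T, (p : ℝ) := by
      rw [← Nat.cast_prod, ← Nat.cast_prod, ← Nat.cast_mul]
      exact Nat.cast_le.2 this
    linarith

/-- Selberg's upper bound sieve, in dual form. -/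
lemma card_sifted_mul_sq_le {P : Finset ℕ} (hP : ∀ p ∈ P, p.Prime) {bad : ℕ → ℕ → Prop}
    {ρ : ℕ → ℕ} (hbad : ∀ p ∈ P, ∀ n, bad p (n + p) ↔ bad p n)
    (hρ : ∀ p ∈ P, ((Finset.range p).filter (bad p)).card = ρ p)
    (h2 : ∀ p ∈ P, 2 * ρ p ≤ p) {𝒯 : Finset (Finset ℕ)} (h𝒯 : 𝒯 ⊆ P.powerset) {D : ℝ}
    (hD : ∀ T ∈ 𝒯, ∏ p ∈ T, (p : ℝ) ≤ D) (L : ℕ) :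
    (((Finset.range L).filter (fun n => ∀ p ∈ P, ¬ bad p n)).card : ℝ) *
        (∑ T ∈ 𝒯, ∏ p ∈ T, (ρ p : ℝ) / (p - ρ p)) ^ 2 ≤
      L * (∑ T ∈ 𝒯, ∏ p ∈ T, (ρ p : ℝ) / (p - ρ p)) + 2 * D ^ 4 := by
  set G := ∑ T ∈ 𝒯, ∏ p ∈ T, (ρ p : ℝ) / (p - ρ p) with hG
  have hsub : ∀ T ∈ 𝒯, T ⊆ P := fun T hT => Finset.mem_powerset.1 (h𝒯 hT)
  set Φ : ℕ → ℝ := fun n => ∑ T ∈ 𝒯, ∏ p ∈ T, sieveWeight bad ρ p n with hΦ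
  have hcard : (𝒯.card : ℝ) * D ≤ D ^ 2 := by
    rcases 𝒯.eq_empty_or_nonempty with h | ⟨T, hT⟩
    · simp [h, sq_nonneg]
    have hD0 : 0 ≤ D := (Finset.prod_nonneg fun p _ => Nat.cast_nonneg p).trans (hD T hT)
    have hle : 𝒯.card ≤ (Finset.Icc 1 ⌊D⌋₊).card := by
      refine Finset.card_le_card_of_injOn (fun T => ∏ p ∈ T, p) (fun T hT => ?_) ?_
      · rw [Finset.coe_Icc, Set.mem_Icc]
        refine ⟨Finset.prod_pos fun p hp => (hP p (hsub T hT hp)).pos, Nat.le_floor ?_⟩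
        rw [Nat.cast_prod]
        exact hD T hT
      · intro S hS T hT hST
        rw [← Nat.primeFactors_prod fun p hp => hP p (hsub S hS hp),
          ← Nat.primeFactors_prod fun p hp => hP p (hsub T hT hp)]
        exact congrArg Nat.primeFactors hST
    rw [Nat.card_Icc, Nat.add_sub_cancel] at hle
    have : (𝒯.card : ℝ) ≤ D := (Nat.cast_le.2 hle).trans (Nat.floor_le hD0)
    nlinarith
  have hsum : ∑ T ∈ 𝒯, ∏ p ∈ T, (p : ℝ) ≤ D ^ 2 := by
    refine le_trans ?_ hcard
    rw [← nsmul_eq_mul]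
    exact Finset.sum_le_card_nsmul _ _ _ hD
  have hsum0 : 0 ≤ ∑ T ∈ 𝒯, ∏ p ∈ T, (p : ℝ) :=
    Finset.sum_nonneg fun T _ => Finset.prod_nonneg fun p _ => Nat.cast_nonneg p
  calc (((Finset.range L).filter (fun n => ∀ p ∈ P, ¬ bad p n)).card : ℝ) * G ^ 2
      = ∑ n ∈ (Finset.range L).filter (fun n => ∀ p ∈ P, ¬ bad p n), Φ n * Φ n := by
        rw [← nsmul_eq_mul, ← Finset.sum_const]
        refine Finset.sum_congr rfl fun n hn => ?_
        have : Φ n = G := by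
          refine Finset.sum_congr rfl fun T hT => Finset.prod_congr rfl fun p hp => ?_
          exact if_neg ((Finset.mem_filter.1 hn).2 p (hsub T hT hp))
        rw [this, sq]
    _ ≤ ∑ n ∈ Finset.range L, Φ n * Φ n :=
        Finset.sum_le_sum_of_subset_of_nonneg (Finset.filter_subset _ _)
          fun n _ _ => mul_self_nonneg _
    _ = ∑ S ∈ 𝒯, ∑ T ∈ 𝒯, ∑ n ∈ Finset.range L,
          (∏ p ∈ S, sieveWeight bad ρ p n) * ∏ p ∈ T, sieveWeight bad ρ p n := by
        simp only [hΦ, Finset.sum_mul_sum]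
        rw [Finset.sum_comm]
        exact Finset.sum_congr rfl fun S _ => Finset.sum_comm
    _ ≤ ∑ S ∈ 𝒯, ∑ T ∈ 𝒯, ((if S = T then L * ∏ p ∈ S, (ρ p : ℝ) / (p - ρ p) else 0) +
          2 * ((∏ p ∈ S, (p : ℝ)) * ∏ p ∈ T, (p : ℝ))) :=
        Finset.sum_le_sum fun S hS => Finset.sum_le_sum fun T hT =>
          sum_prod_sieveWeight_le hP hbad hρ h2 (hsub S hS) (hsub T hT) L
    _ = L * G + 2 * ((∑ T ∈ 𝒯, ∏ p ∈ T, (p : ℝ)) * ∑ T ∈ 𝒯, ∏ p ∈ T, (p : ℝ)) := by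
        simp only [Finset.sum_add_distrib, Finset.sum_ite_eq, Finset.sum_mul_sum,
          ← Finset.mul_sum]
        congr 1
        rw [hG, Finset.mul_sum]
        exact Finset.sum_congr rfl fun S hS => by simp [hS]
    _ ≤ L * G + 2 * D ^ 4 := by nlinarith

/-- Rankin's trick: truncating at `y ^ 17` costs at most half of the Euler product. -/
lemma half_prod_le_sum_truncated {y : ℝ} (hy : 4 ≤ y) {P : Finset ℕ} (hP : ∀ p ∈ P, p.Prime)
    (hPy : ∀ p ∈ P, (p : ℝ) ≤ y) {g : ℕ → ℝ} (hg0 : ∀ p ∈ P, 0 ≤ g p)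
    (hg : ∀ p ∈ P, g p ≤ 4 / p) :
    (∏ p ∈ P, (1 + g p)) / 2 ≤
      ∑ T ∈ P.powerset.filter (fun T : Finset ℕ => ∏ p ∈ T, (p : ℝ) ≤ y ^ 17), ∏ p ∈ T, g p := by
  have hlog1 : 1 ≤ Real.log 4 := by
    rw [show (4 : ℝ) = 2 ^ 2 by norm_num, Real.log_pow]
    have := Real.log_two_gt_d9
    push_cast; linarith
  have hlogy : Real.log 4 ≤ Real.log y := Real.log_le_log (by norm_num) hy
  have hl0 : 0 < Real.log y := by linarith
  have hp0 : ∀ p ∈ P, (0 : ℝ) < p := fun p hp => by exact_mod_cast (hP p hp).pos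
  set e : ℕ → ℝ := fun p => Real.exp (Real.log p / Real.log y) with he
  have hmertens : ∑ p ∈ P, Real.log p / p ≤ 2 * Real.log y := by
    calc ∑ p ∈ P, Real.log p / p ≤ ∑ p ∈ ⌊y⌋₊.primesLE, Real.log p / p := by
          refine Finset.sum_le_sum_of_subset_of_nonneg (fun p hp => ?_) fun p _ _ =>
            div_nonneg (Real.log_natCast_nonneg p) (Nat.cast_nonneg p)
          exact Nat.mem_primesBelow.2 ⟨Nat.lt_succ_of_le (Nat.le_floor (hPy p hp)), hP p hp⟩
      _ ≤ Real.log ⌊y⌋₊ + Real.log 4 :=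
          sum_primesLE_log_div_le (Nat.le_floor (by push_cast; linarith))
      _ ≤ 2 * Real.log y := by
          have : Real.log ⌊y⌋₊ ≤ Real.log y :=
            Real.log_le_log (by exact_mod_cast Nat.floor_pos.2 (by linarith))
              (Nat.floor_le (by linarith))
          linarith
  have hfactor : ∀ p ∈ P, 1 + g p * e p ≤
      (1 + g p) * Real.exp (8 / Real.log y * (Real.log p / p)) := by
    intro p hp
    have ht0 : 0 ≤ Real.log p / Real.log y := div_nonneg (Real.log_natCast_nonneg p) hl0.le
    have ht1 : Real.log p / Real.log y ≤ 1 :=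
      div_le_one_of_le₀ (Real.log_le_log (hp0 p hp) (hPy p hp)) hl0.le
    have hexp := (abs_le.1 (Real.abs_exp_sub_one_sub_id_le
      (x := Real.log p / Real.log y) (by rw [abs_of_nonneg ht0]; exact ht1))).2
    have h1 : e p - 1 ≤ 2 * (Real.log p / Real.log y) := by
      simp only [he]; nlinarith
    have h1' : 0 ≤ e p - 1 := by
      have := Real.add_one_le_exp (Real.log p / Real.log y)
      simp only [he]; linarith
    have h3 : g p * (e p - 1) ≤ 8 / Real.log y * (Real.log p / p) := by
      calc g p * (e p - 1) ≤ 4 / p * (2 * (Real.log p / Real.log y)) :=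
            mul_le_mul (hg p hp) h1 h1' (by positivity)
        _ = _ := by ring
    have h4 := Real.add_one_le_exp (8 / Real.log y * (Real.log p / p))
    have h5 : 1 + g p * (e p - 1) ≤ Real.exp (8 / Real.log y * (Real.log p / p)) := by linarith
    have := hg0 p hp
    calc 1 + g p * e p ≤ (1 + g p) * (1 + g p * (e p - 1)) := by
          nlinarith [mul_nonneg (mul_nonneg this this) h1']
      _ ≤ _ := by gcongr
  have hW0 : 0 ≤ ∏ p ∈ P, (1 + g p) := Finset.prod_nonneg fun p hp => by linarith [hg0 p hp]
  have htwist : ∏ p ∈ P, (1 + g p * e p) ≤ (∏ p ∈ P, (1 + g p)) * Real.exp 16 := by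
    calc ∏ p ∈ P, (1 + g p * e p)
        ≤ ∏ p ∈ P, ((1 + g p) * Real.exp (8 / Real.log y * (Real.log p / p))) :=
          Finset.prod_le_prod (fun p hp => by
            have := mul_nonneg (hg0 p hp) (Real.exp_pos (Real.log p / Real.log y)).le
            simp only [he]; linarith) hfactor
      _ = (∏ p ∈ P, (1 + g p)) * Real.exp (8 / Real.log y * ∑ p ∈ P, Real.log p / p) := by
          rw [Finset.prod_mul_distrib, ← Real.exp_sum, Finset.mul_sum]
      _ ≤ _ := by
          gcongr
          calc 8 / Real.log y * ∑ p ∈ P, Real.log p / p ≤ 8 / Real.log y * (2 * Real.log y) := by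
                gcongr
            _ = 16 := by field_simp; norm_num
  have htail : ∑ T ∈ P.powerset.filter (fun T : Finset ℕ => ¬ ∏ p ∈ T, (p : ℝ) ≤ y ^ 17), ∏ p ∈ T, g p ≤
      Real.exp (-17) * ∏ p ∈ P, (1 + g p * e p) := by
    rw [Finset.prod_one_add, Finset.mul_sum]
    have hnn : ∀ T ∈ P.powerset, 0 ≤ ∏ p ∈ T, g p * e p := fun T hT =>
      Finset.prod_nonneg fun p hp =>
        mul_nonneg (hg0 p (Finset.mem_powerset.1 hT hp)) (Real.exp_pos _).le
    refine (Finset.sum_le_sum fun T hT => ?_).trans (Finset.sum_le_sum_of_subset_of_nonneg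
      (Finset.filter_subset _ _) fun T hT _ => mul_nonneg (Real.exp_pos _).le (hnn T hT))
    obtain ⟨hTP, hTy⟩ := Finset.mem_filter.1 hT
    rw [Finset.mem_powerset] at hTP
    have hlogT : 17 ≤ ∑ p ∈ T, Real.log p / Real.log y := by
      rw [← Finset.sum_div, ← Real.log_prod fun p hp => (hp0 p (hTP hp)).ne', le_div_iff₀ hl0]
      have := Real.log_le_log (by positivity) (not_le.1 hTy).le
      rw [Real.log_pow] at this
      exact_mod_cast this
    rw [Finset.prod_mul_distrib, he, ← Real.exp_sum, mul_left_comm, ← Real.exp_add]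
    refine le_mul_of_one_le_right (Finset.prod_nonneg fun p hp => hg0 p (hTP hp)) ?_
    exact Real.one_le_exp (by linarith)
  have hsplit := Finset.sum_filter_add_sum_filter_not P.powerset
    (fun T : Finset ℕ => ∏ p ∈ T, (p : ℝ) ≤ y ^ 17) (fun T => ∏ p ∈ T, g p)
  rw [← Finset.prod_one_add] at hsplit
  have hexp : Real.exp (-17) * Real.exp 16 ≤ 1 / 2 := by
    rw [← Real.exp_add, show (-17 + 16 : ℝ) = -1 by norm_num, Real.exp_neg, one_div]
    exact inv_anti₀ (by norm_num) (by linarith [Real.add_one_le_exp (1 : ℝ)])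
  have : Real.exp (-17) * ∏ p ∈ P, (1 + g p * e p) ≤ 1 / 2 * ∏ p ∈ P, (1 + g p) := by
    calc _ ≤ Real.exp (-17) * ((∏ p ∈ P, (1 + g p)) * Real.exp 16) := by gcongr
      _ = (Real.exp (-17) * Real.exp 16) * ∏ p ∈ P, (1 + g p) := by ring
      _ ≤ _ := by gcongr
  linarith

/-- Upper bound sieve of level `y ^ 17` with main term the full Euler product. -/
lemma card_sifted_le {y : ℝ} (hy : 4 ≤ y) {P : Finset ℕ} (hP : ∀ p ∈ P, p.Prime)
    (hPy : ∀ p ∈ P, (p : ℝ) ≤ y) {bad : ℕ → ℕ → Prop}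
    {ρ : ℕ → ℕ} (hbad : ∀ p ∈ P, ∀ n, bad p (n + p) ↔ bad p n)
    (hρ : ∀ p ∈ P, ((Finset.range p).filter (bad p)).card = ρ p)
    (hρ2 : ∀ p ∈ P, ρ p ≤ 2) (hP4 : ∀ p ∈ P, 4 ≤ p) (L : ℕ) :
    (((Finset.range L).filter (fun n => ∀ p ∈ P, ¬ bad p n)).card : ℝ) ≤
      2 * L / (∏ p ∈ P, (1 + (ρ p : ℝ) / (p - ρ p))) + 2 * y ^ 68 := by
  have h2 : ∀ p ∈ P, 2 * ρ p ≤ p := fun p hp => by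
    have := hρ2 p hp
    have := hP4 p hp
    omega
  have hmain := card_sifted_mul_sq_le hP hbad hρ h2
    (Finset.filter_subset (fun T : Finset ℕ => ∏ p ∈ T, (p : ℝ) ≤ y ^ 17) P.powerset)
    (fun T hT => (Finset.mem_filter.1 hT).2) L
  have hG := half_prod_le_sum_truncated hy hP hPy (g := fun p => (ρ p : ℝ) / (p - ρ p))
    (fun p hp => sieveDensity_nonneg (h2 p hp)) fun p hp => by
      have h4 : (4 : ℝ) ≤ p := by exact_mod_cast hP4 p hp
      have hr : (ρ p : ℝ) ≤ 2 := by exact_mod_cast hρ2 p hp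
      rw [div_le_div_iff₀ (by linarith) (by linarith)]
      nlinarith
  have hG1 : 1 ≤ ∑ T ∈ P.powerset.filter (fun T : Finset ℕ => ∏ p ∈ T, (p : ℝ) ≤ y ^ 17),
      ∏ p ∈ T, (ρ p : ℝ) / (p - ρ p) := by
    have hmem : (∅ : Finset ℕ) ∈ P.powerset.filter (fun T : Finset ℕ => ∏ p ∈ T, (p : ℝ) ≤ y ^ 17) := by
      simp [one_le_pow₀ (show 1 ≤ y by linarith)]
    have := Finset.single_le_sum (f := fun T => ∏ p ∈ T, (ρ p : ℝ) / (p - ρ p))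
      (fun T hT => Finset.prod_nonneg fun p hp => sieveDensity_nonneg (h2 p
        (Finset.mem_powerset.1 (Finset.mem_filter.1 hT).1 hp))) hmem
    simpa using this
  set G := ∑ T ∈ P.powerset.filter (fun T : Finset ℕ => ∏ p ∈ T, (p : ℝ) ≤ y ^ 17),
      ∏ p ∈ T, (ρ p : ℝ) / (p - ρ p)
  set W := ∏ p ∈ P, (1 + (ρ p : ℝ) / (p - ρ p))
  have hW : 0 < W := Finset.prod_pos fun p hp => by
    linarith [sieveDensity_nonneg (h2 p hp)]
  have hy0 : 0 ≤ 2 * y ^ 68 := by positivity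
  have hLW : L / G ≤ 2 * L / W := by
    rw [div_le_div_iff₀ (by linarith) hW]
    nlinarith [Nat.cast_nonneg (α := ℝ) L]
  have h3 : 2 * y ^ 68 / G ^ 2 ≤ 2 * y ^ 68 := div_le_self hy0 (one_le_pow₀ hG1)
  rw [← le_div_iff₀ (by positivity)] at hmain
  have h4 : (L * G + 2 * (y ^ 17) ^ 4) / G ^ 2 = L / G + 2 * y ^ 68 / G ^ 2 := by
    have : G ≠ 0 := by linarith
    field_simp
  rw [h4] at hmain
  linarith

lemma log_div_log_le_prod_primes_Ioc {y z : ℝ} (hz : 4 ≤ z) (hzy : z ≤ y) :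
    Real.log y / (2 * Real.exp 4 * Real.log z) ≤
      ∏ p ∈ ⌊y⌋₊.primesLE.filter (fun p : ℕ => z < p), (p : ℝ) / (p - 1) := by
  have hone : ∀ p ∈ ⌊y⌋₊.primesLE, (0 : ℝ) ≤ p / (p - 1) := fun p hp => by
    have h2 : (2 : ℝ) ≤ p := by exact_mod_cast (Nat.prime_of_mem_primesBelow hp).two_le
    exact div_nonneg (by linarith) (by linarith)
  have hlow : ⌊y⌋₊.primesLE.filter (fun p : ℕ => ¬ z < p) = ⌊z⌋₊.primesLE := by
    ext p
    simp only [Finset.mem_filter, Nat.primesLE, Nat.mem_primesBelow, Nat.lt_succ_iff, not_lt,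
      Nat.le_floor_iff (show 0 ≤ z by linarith), Nat.le_floor_iff (show 0 ≤ y by linarith)]
    constructor
    · rintro ⟨⟨_, h⟩, h'⟩
      exact ⟨h', h⟩
    · rintro ⟨h, h'⟩
      exact ⟨⟨h.trans hzy, h'⟩, h⟩
  have hsplit := Finset.prod_filter_mul_prod_filter_not ⌊y⌋₊.primesLE (fun p : ℕ => z < p)
    (fun p => (p : ℝ) / (p - 1))
  rw [hlow] at hsplit
  have hz4 : 4 ≤ ⌊z⌋₊ := Nat.le_floor (by exact_mod_cast hz)
  have hupper : ∏ p ∈ ⌊z⌋₊.primesLE, (p : ℝ) / (p - 1) ≤ 2 * Real.exp 4 * Real.log z :=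
    (prod_primesLE_le hz4).trans (by
      gcongr
      exact Nat.floor_le (by linarith))
  have hlower : Real.log y ≤ ∏ p ∈ ⌊y⌋₊.primesLE, (p : ℝ) / (p - 1) :=
    (Real.log_le_log (by linarith) (Nat.lt_floor_add_one y).le).trans
      (log_add_one_le_prod_primesLE _)
  have hlogz : 0 < Real.log z := Real.log_pos (by linarith)
  rw [div_le_iff₀ (by positivity)]
  calc Real.log y ≤ _ := hlower
    _ = _ := hsplit.symm
    _ ≤ _ := by
      gcongr
      exact Finset.prod_nonneg fun p hp => hone p (Finset.filter_subset _ _ hp)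

lemma dvd_linear_iff {p M : ℕ} [Fact p.Prime] (hM : ¬ p ∣ M) (b c : ℤ) (n : ℕ) :
    (p : ℤ) ∣ b + (n + c) * M ↔ (n : ZMod p) = -b / M - c := by
  have hM0 : (M : ZMod p) ≠ 0 := by rwa [Ne, ZMod.natCast_eq_zero_iff]
  rw [← ZMod.intCast_zmod_eq_zero_iff_dvd, eq_sub_iff_add_eq, eq_div_iff hM0]
  push_cast
  rw [eq_neg_iff_add_eq_zero, add_comm]

/-- The number of residue classes sifted at `p` for the pair of forms `b + n M`,
`b + (n + h) M`. -/
def pairDensity (h : ℤ) (p : ℕ) : ℕ := if (p : ℤ) ∣ h then 1 else 2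

lemma card_range_dvd_mul_linear {p M : ℕ} (hp : p.Prime) (hM : ¬ p ∣ M) (b h : ℤ) :
    ((Finset.range p).filter
      (fun n : ℕ => (p : ℤ) ∣ (b + n * M) * (b + (n + h) * M))).card =
      pairDensity h p := by
  have : Fact p.Prime := ⟨hp⟩
  set x : ZMod p := -b / M with hx
  have heq : (Finset.range p).filter
      (fun n : ℕ => (p : ℤ) ∣ (b + n * M) * (b + (n + h) * M)) = {x.val, (x - h).val} := by
    ext n
    have hval : ∀ w : ZMod p, n = w.val ↔ n < p ∧ (n : ZMod p) = w := fun w => by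
      constructor
      · rintro rfl
        exact ⟨ZMod.val_lt w, ZMod.natCast_zmod_val w⟩
      · rintro ⟨hlt, rfl⟩
        exact (ZMod.val_natCast_of_lt hlt).symm
    have h0 := dvd_linear_iff hM b 0 n
    rw [add_zero, Int.cast_zero, sub_zero] at h0
    rw [Finset.mem_filter, Finset.mem_range, (Nat.prime_iff_prime_int.1 hp).dvd_mul, h0,
      dvd_linear_iff hM b h n, Finset.mem_insert, Finset.mem_singleton, hval, hval]
    tauto
  rw [heq, pairDensity]
  split_ifs with hh
  · rw [(ZMod.intCast_zmod_eq_zero_iff_dvd h p).2 hh]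
    simp
  · rw [Finset.card_pair]
    intro hv
    have := ZMod.val_injective p hv
    rw [eq_comm, sub_eq_self, ZMod.intCast_zmod_eq_zero_iff_dvd] at this
    exact hh this

lemma card_small_values_le {M : ℕ} (hM : M ≠ 0) (b c : ℤ) (L k : ℕ) :
    ((Finset.range L).filter (fun n : ℕ => (b + (n + c) * M).natAbs ≤ k)).card ≤ 2 * k + 1 := by
  have h : ((Finset.range L).filter (fun n : ℕ => (b + (n + c) * M).natAbs ≤ k)).card ≤
      (Finset.Icc (-(k : ℤ)) k).card := by
    refine Finset.card_le_card_of_injOn (fun n => b + (n + c) * M) (fun n hn => ?_) ?_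
    · have := (Finset.mem_filter.1 hn).2
      rw [Finset.coe_Icc, Set.mem_Icc]
      dsimp only
      omega
    · intro n _ m _ hnm
      have hM' : (M : ℤ) ≠ 0 := by exact_mod_cast hM
      have := mul_right_cancel₀ hM' (add_left_cancel hnm)
      omega
  rw [Int.card_Icc] at h
  omega

lemma natAbs_eq_of_prime_dvd {p : ℕ} (hp : p.Prime) {a : ℤ} (ha : Prime a) (h : (p : ℤ) ∣ a) :
    a.natAbs = p := by
  rw [Int.natCast_dvd] at h
  exact ((Nat.prime_dvd_prime_iff_eq hp (Int.prime_iff_natAbs_prime.1 ha)).1 h).symm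

lemma card_prime_pairs_le {y z : ℝ} (hz : 4 ≤ z) (hy : 4 ≤ y) {M : ℕ} (hM0 : M ≠ 0)
    (hM : ∀ p : ℕ, p.Prime → z < p → ¬ p ∣ M) (b h : ℤ) {N' : ℕ} (hN' : 1 ≤ N') :
    (((Finset.range (N' + 1)).filter (fun n : ℕ =>
        Prime (b + n * M) ∧ Prime (b + (n + h) * M))).card : ℝ) ≤
      4 * N' / (∏ p ∈ ⌊y⌋₊.primesLE.filter (fun p : ℕ => z < p),
        (1 + (pairDensity h p : ℝ) / (p - pairDensity h p))) + 8 * y ^ 68 := by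
  set P := ⌊y⌋₊.primesLE.filter (fun p : ℕ => z < p) with hPdef
  set bad : ℕ → ℕ → Prop := fun p n => (p : ℤ) ∣ (b + n * M) * (b + (n + h) * M) with hbad
  have hP : ∀ p ∈ P, p.Prime := fun p hp =>
    Nat.prime_of_mem_primesBelow (Finset.mem_filter.1 hp).1
  have hPle : ∀ p ∈ P, p ≤ ⌊y⌋₊ := fun p hp =>
    Nat.lt_succ_iff.1 (Nat.lt_of_mem_primesBelow (Finset.mem_filter.1 hp).1)
  have hPz : ∀ p ∈ P, z < p := fun p hp => (Finset.mem_filter.1 hp).2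
  have hsieve := card_sifted_le hy hP (fun p hp => (Nat.le_floor_iff (by linarith)).1 (hPle p hp))
    (bad := bad) (ρ := pairDensity h) (fun p _ n => ?_)
    (fun p hp => by
      convert card_range_dvd_mul_linear (hP p hp) (hM p (hP p hp) (hPz p hp)) b h)
    (fun p _ => by unfold pairDensity; split_ifs <;> norm_num)
    (fun p hp => by exact_mod_cast (hz.trans (hPz p hp).le)) (N' + 1)
  swap
  · simp only [hbad]
    rw [← sub_add_cancel ((b + ((n + p : ℕ) : ℤ) * M) * (b + (((n + p : ℕ) : ℤ) + h) * M))
      ((b + n * M) * (b + (n + h) * M))]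
    refine dvd_add_right ⟨M * (b + (n + p + h) * M) + M * (b + n * M), ?_⟩
    push_cast
    ring
  set W := ∏ p ∈ P, (1 + (pairDensity h p : ℝ) / (p - pairDensity h p)) with hW
  have hW0 : 0 ≤ W := Finset.prod_nonneg fun p hp => by
    have h1 : (pairDensity h p : ℝ) ≤ 2 := by
      unfold pairDensity; split_ifs <;> norm_num
    have h2 := hPz p hp
    have : 0 ≤ (pairDensity h p : ℝ) / (p - pairDensity h p) :=
      div_nonneg (Nat.cast_nonneg _) (by linarith)
    linarith
  have hcover : (Finset.range (N' + 1)).filter (fun n : ℕ =>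
        Prime (b + n * M) ∧ Prime (b + (n + h) * M)) ⊆
      (Finset.range (N' + 1)).filter (fun n => ∀ p ∈ P, ¬ bad p n) ∪
      ((Finset.range (N' + 1)).filter (fun n : ℕ => (b + (n + 0) * M : ℤ).natAbs ≤ ⌊y⌋₊) ∪
      (Finset.range (N' + 1)).filter (fun n : ℕ => (b + (n + h) * M : ℤ).natAbs ≤ ⌊y⌋₊)) := by
    intro n hn
    obtain ⟨hn, h1, h2⟩ := Finset.mem_filter.1 hn
    simp only [Finset.mem_union, Finset.mem_filter, hn, true_and, add_zero]
    by_contra! hc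
    obtain ⟨⟨p, hpP, hp⟩, hc1, hc2⟩ := hc
    rcases (Nat.prime_iff_prime_int.1 (hP p hpP)).dvd_mul.1 hp with hd | hd
    · rw [natAbs_eq_of_prime_dvd (hP p hpP) h1 hd] at hc1
      exact hc1.not_ge (hPle p hpP)
    · rw [natAbs_eq_of_prime_dvd (hP p hpP) h2 hd] at hc2
      exact hc2.not_ge (hPle p hpP)
  have hcard := (Finset.card_le_card hcover).trans ((Finset.card_union_le _ _).trans
    (Nat.add_le_add_left ((Finset.card_union_le _ _).trans (Nat.add_le_add
      (card_small_values_le hM0 b 0 (N' + 1) ⌊y⌋₊) (card_small_values_le hM0 b h (N' + 1) ⌊y⌋₊))) _))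
  have hcard' := Nat.cast_le (α := ℝ).2 hcard
  push_cast at hcard'
  have hfl : (⌊y⌋₊ : ℝ) ≤ y := Nat.floor_le (by linarith)
  have hy1 : y ≤ y ^ 68 := le_self_pow₀ (by linarith) (by norm_num)
  have hL : 2 * ((N' + 1 : ℕ) : ℝ) / W ≤ 4 * N' / W := by
    have : (1 : ℝ) ≤ N' := by exact_mod_cast hN'
    refine div_le_div_of_nonneg_right ?_ hW0
    push_cast
    linarith
  have hsieve' : (((Finset.range (N' + 1)).filter (fun n => ∀ p ∈ P, ¬ bad p n)).card : ℝ) ≤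
      2 * ((N' + 1 : ℕ) : ℝ) / W + 2 * y ^ 68 := by convert hsieve
  linarith

lemma one_add_pairDensity_of_dvd {h : ℤ} {p : ℕ} (hp : (2 : ℝ) ≤ p) (hd : (p : ℤ) ∣ h) :
    1 + (pairDensity h p : ℝ) / (p - pairDensity h p) = p / (p - 1) := by
  have : (p : ℝ) - 1 ≠ 0 := by linarith
  simp only [pairDensity, hd, if_true, Nat.cast_one]
  field_simp
  ring

lemma sq_prod_le_prod_pairDensity {z : ℝ} (hz : 4 ≤ z) {P : Finset ℕ}
    (hP : ∀ p ∈ P, p.Prime) (hPz : ∀ p ∈ P, z < p) {h : ℤ} (hh : h ≠ 0) :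
    (∏ p ∈ P, (p : ℝ) / (p - 1)) ^ 2 ≤
      (∏ p ∈ P, (1 + (pairDensity h p : ℝ) / (p - pairDensity h p))) *
        ∏ p ∈ h.natAbs.primeFactors.filter (fun p : ℕ => z < p), (p : ℝ) / (p - 1) := by
  have hterm : ∀ p : ℕ, z < p → (1 : ℝ) ≤ p / (p - 1) := fun p hp => by
    rw [le_div_iff₀ (by linarith)]
    linarith
  have hfilter : ∏ p ∈ P.filter (fun p : ℕ => (p : ℤ) ∣ h), (p : ℝ) / (p - 1) ≤
      ∏ p ∈ h.natAbs.primeFactors.filter (fun p : ℕ => z < p), (p : ℝ) / (p - 1) := by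
    refine Finset.prod_le_prod_of_subset_of_one_le (fun p hp => ?_) (fun p hp => ?_)
      fun p hp _ => hterm p (Finset.mem_filter.1 hp).2
    · obtain ⟨hp, hd⟩ := Finset.mem_filter.1 hp
      rw [Finset.mem_filter, Nat.mem_primeFactors]
      exact ⟨⟨hP p hp, Int.natCast_dvd.1 hd, Int.natAbs_ne_zero.2 hh⟩, hPz p hp⟩
    · linarith [hterm p (hPz p (Finset.mem_filter.1 hp).1)]
  have hnonneg : ∀ p ∈ P, 0 ≤ 1 + (pairDensity h p : ℝ) / (p - pairDensity h p) := fun p hp => by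
    have h1 : (pairDensity h p : ℝ) ≤ 2 := by
      unfold pairDensity; split_ifs <;> norm_num
    have h2 := hPz p hp
    have : 0 ≤ (pairDensity h p : ℝ) / (p - pairDensity h p) :=
      div_nonneg (Nat.cast_nonneg _) (by linarith)
    linarith
  refine le_trans ?_ (mul_le_mul_of_nonneg_left hfilter (Finset.prod_nonneg hnonneg))
  rw [Finset.prod_filter, ← Finset.prod_mul_distrib, ← Finset.prod_pow]
  refine Finset.prod_le_prod (fun p _ => sq_nonneg _) fun p hp => ?_
  have hpz := hPz p hp
  split_ifs with hd
  · rw [one_add_pairDensity_of_dvd (by linarith) hd, sq]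
  · simp only [pairDensity, hd, if_false, mul_one]
    have h1 : (0 : ℝ) < p - 1 := by linarith
    have h2 : (0 : ℝ) < p - 2 := by linarith
    have h3 : 1 + ((2 : ℕ) : ℝ) / (p - (2 : ℕ)) = p / (p - 2) := by
      push_cast
      field_simp
      ring
    rw [h3, div_pow, div_le_div_iff₀ (by positivity) h2]
    nlinarith

lemma sqrt_exp_le_of_primorial {N : ℕ} (hN : 1 ≤ N) {M N' : ℕ}
    (hM : M = primorial ⌊Real.log N / 3⌋₊) (hN' : ⌈(2 * N : ℝ) / M⌉₊ < N') :
    Real.exp (Real.log N / 2) ≤ N' := by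
  have hN0 : (0 : ℝ) < N := by exact_mod_cast hN
  have hl0 : 0 ≤ Real.log N := Real.log_natCast_nonneg N
  have hM0 : (0 : ℝ) < M := by
    rw [hM]
    exact_mod_cast primorial_pos _
  have hM1 : (M : ℝ) ≤ Real.exp (Real.log N / 2) := by
    calc (M : ℝ) ≤ (4 : ℝ) ^ ⌊Real.log N / 3⌋₊ := by
          rw [hM]
          exact_mod_cast primorial_le_four_pow _
      _ = Real.exp (Real.log 4 * ⌊Real.log N / 3⌋₊) := by
          rw [← Real.rpow_natCast, Real.rpow_def_of_pos (by norm_num)]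
      _ ≤ Real.exp (3 / 2 * (Real.log N / 3)) := by
          have h4 : Real.log 4 ≤ 3 / 2 := by
            rw [show (4 : ℝ) = 2 ^ 2 by norm_num, Real.log_pow]
            have := Real.log_two_lt_d9
            push_cast
            linarith
          have := Nat.floor_le (show 0 ≤ Real.log N / 3 by positivity)
          gcongr
      _ = _ := by ring_nf
  have h1 : (2 * N : ℝ) / M ≤ N' := (Nat.le_ceil _).trans (by exact_mod_cast hN'.le)
  have h2 : (N : ℝ) = Real.exp (Real.log N / 2) * Real.exp (Real.log N / 2) := by
    rw [← Real.exp_add, add_halves, Real.exp_log hN0]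
  refine le_trans ?_ h1
  rw [le_div_iff₀ hM0]
  have := Real.exp_pos (Real.log N / 2)
  nlinarith

lemma tsum_shift_mul_le {lam : ℤ → ℝ} {A : ℤ → Prop} [DecidablePred A] {K : ℝ} {N' : ℕ}
    (hlam : lam = fun n => if 1 ≤ n ∧ n ≤ (N' : ℤ) ∧ A n then K else 0) (m₁ m₂ : ℤ) :
    ∑' n : ℤ, lam (n + m₁) * lam (n + m₂) ≤
      K ^ 2 * ((Finset.range (N' + 1)).filter
        (fun n : ℕ => A n ∧ A (n + (m₁ - m₂)))).card := by
  have hshift := (Equiv.addRight m₂).tsum_eq (fun n => lam (n + (m₁ - m₂)) * lam n)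
  simp only [Equiv.coe_addRight, add_assoc, add_sub_cancel] at hshift
  rw [hshift, tsum_eq_sum (s := (Finset.range (N' + 1)).map Nat.castEmbedding), Finset.sum_map,
    mul_comm, ← nsmul_eq_mul, ← Finset.sum_const, Finset.sum_filter]
  · refine Finset.sum_le_sum fun n _ => ?_
    simp only [hlam, Nat.castEmbedding_apply]
    split_ifs <;> first | nlinarith [sq_nonneg K] | tauto
  · intro n hn
    have : ¬ (1 ≤ n ∧ n ≤ (N' : ℤ) ∧ A n) := by
      rintro ⟨h1, h2, _⟩
      refine hn (Finset.mem_map.2 ⟨n.toNat, Finset.mem_range.2 (by omega), ?_⟩)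
      simp only [Nat.castEmbedding_apply]
      omega
    rw [hlam]
    simp only [this, if_false, mul_zero]

lemma eight_mul_sq_mul_exp_le {l : ℝ} (hl : 30000 ≤ l) :
    8 * Real.exp (l / 200) ^ 68 * l ^ 2 ≤ Real.exp (l / 2) := by
  have h := Real.pow_div_factorial_le_exp (4 * l / 25) (by linarith) 3
  have h6 : ((Nat.factorial 3 : ℕ) : ℝ) = 6 := by norm_num [Nat.factorial]
  rw [h6] at h
  have h1 : 8 * l ^ 2 ≤ Real.exp (4 * l / 25) := by
    refine le_trans ?_ h
    nlinarith [sq_nonneg l]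
  have h2 : Real.exp (l / 2) = Real.exp (l / 200) ^ 68 * Real.exp (4 * l / 25) := by
    rw [← Real.exp_nat_mul, ← Real.exp_add]
    congr 1
    push_cast
    ring
  rw [h2]
  nlinarith [pow_pos (Real.exp_pos (l / 200)) 68]

/-- **Sieve bound on autocorrelations (Lemma 3).**
There is an absolute constant `C` such that for all sufficiently large `N`, with
`z = (log N)/3`, `M = ∏_{q ≤ z, q prime} q`, `N'` the least prime exceeding `⌈2N/M⌉`,
`b` coprime to `M`, and `λ(n) = log N/(N' log z)` if `1 ≤ n ≤ N'` and `b + nM` is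
prime (and `0` otherwise): for all integers `m₁, m₂`,
`∑_n λ(n+m₁)λ(n+m₂) ≤ C·log N/(N' log z)` if `m₁ = m₂`, and
`∑_n λ(n+m₁)λ(n+m₂) ≤ (C/N')·∏_{p > z, p | m₁−m₂} p/(p−1)` if `m₁ ≠ m₂`. -/
theorem sieve_autocorrelation :
    ∃ C : ℝ, ∃ N₀ : ℕ, ∀ N : ℕ, N₀ ≤ N →
      ∀ z : ℝ, z = Real.log N / 3 →
        ∀ M : ℕ, M = ∏ q ∈ Finset.filter Nat.Prime (Finset.range (⌊z⌋₊ + 1)), q →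
          ∀ N' : ℕ, Nat.Prime N' →
            ⌈(2 * N : ℝ) / M⌉₊ < N' →
            (∀ q : ℕ, Nat.Prime q → ⌈(2 * N : ℝ) / M⌉₊ < q → N' ≤ q) →
            ∀ b : ℤ, Int.gcd b M = 1 →
              ∀ lam : ℤ → ℝ,
                (lam = fun n =>
                  if 1 ≤ n ∧ n ≤ (N' : ℤ) ∧ Prime (b + n * M) then
                    Real.log N / (N' * Real.log z) else 0) →
                ∀ m₁ m₂ : ℤ,
                  (m₁ = m₂ →
                    ∑' n : ℤ, lam (n + m₁) * lam (n + m₂) ≤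
                      C * Real.log N / (N' * Real.log z)) ∧
                  (m₁ ≠ m₂ →
                    ∑' n : ℤ, lam (n + m₁) * lam (n + m₂) ≤
                      (C / N') * ∏ p ∈ (m₁ - m₂).natAbs.primeFactors.filter
                        (fun p : ℕ => z < (p : ℝ)), (p : ℝ) / ((p : ℝ) - 1)) := by
  set A : ℝ := 400 * Real.exp 4 with hA
  have hA1 : 1 ≤ A := by linarith [Real.add_one_le_exp (4 : ℝ)]
  refine ⟨4 * A ^ 2 + 1, ⌈Real.exp 30000⌉₊, ?_⟩
  intro N hN z hz M hM N' hN'p hN' _ b _ lam hlam m₁ m₂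
  have hexpN : Real.exp 30000 ≤ N := Nat.ceil_le.1 hN
  have hN0 : (0 : ℝ) < N := (Real.exp_pos _).trans_le hexpN
  have hl : 30000 ≤ Real.log N := (Real.le_log_iff_exp_le hN0).2 hexpN
  have hsize := sqrt_exp_le_of_primorial (by exact_mod_cast hN0) (hz ▸ hM) hN'
  have herr := (eight_mul_sq_mul_exp_le hl).trans hsize
  set l := Real.log N with hldef
  set y := Real.exp (l / 200) with hy
  have hy2 := Real.pow_div_factorial_le_exp (l / 200) (by linarith) 2
  have hzy : z ≤ y := by
    refine le_trans ?_ hy2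
    rw [hz, Nat.factorial_two]
    push_cast
    nlinarith
  have hz4 : 4 ≤ z := by linarith
  have hlogz : 1 ≤ Real.log z := by
    rw [Real.le_log_iff_exp_le (by linarith)]
    linarith [Real.exp_one_lt_d9]
  have hlogzl : Real.log z ≤ l := (Real.log_le_self (by linarith)).trans (by linarith)
  have hM0 : M ≠ 0 := by
    rw [hM]
    exact primorial_ne_zero _
  have hMcop : ∀ p : ℕ, p.Prime → z < p → ¬ p ∣ M := fun p hp hzp hd => by
    rw [hM] at hd
    exact hzp.not_ge ((Nat.le_floor_iff (by linarith)).1 (hp.dvd_primorial_iff.1 hd))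
  have hn0 : (0 : ℝ) < N' := by exact_mod_cast hN'p.pos
  have hcount := card_prime_pairs_le hz4 (hz4.trans hzy) hM0 hMcop b (m₁ - m₂) hN'p.one_lt.le
  have hV := log_div_log_le_prod_primes_Ioc hz4 hzy
  have hsum := tsum_shift_mul_le (A := fun n => Prime (b + n * M)) hlam m₁ m₂
  set t := l / Real.log z with ht
  have ht1 : 1 ≤ t := (one_le_div (by linarith)).2 hlogzl
  have htl : t ≤ l := div_le_self (by linarith) hlogz
  have hK : l / (N' * Real.log z) = t / N' := by
    rw [ht, div_div, mul_comm]
  have hlogy : Real.log y / (2 * Real.exp 4 * Real.log z) = t / A := by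
    rw [hy, Real.log_exp, ht, hA]
    field_simp
    ring
  rw [hlogy] at hV
  set P := ⌊y⌋₊.primesLE.filter (fun p : ℕ => z < p) with hP
  have hPp : ∀ p ∈ P, p.Prime := fun p hp =>
    Nat.prime_of_mem_primesBelow (Finset.mem_filter.1 hp).1
  have hPz : ∀ p ∈ P, z < p := fun p hp => (Finset.mem_filter.1 hp).2
  have hA0 : 0 < A := by linarith
  have ht0 : 0 < t := by linarith
  have herr' : 8 * y ^ 68 ≤ N' / t ^ 2 := by
    rw [le_div_iff₀ (by positivity)]
    refine le_trans ?_ herr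
    gcongr
  set c : ℝ := (((Finset.range (N' + 1)).filter (fun n : ℕ =>
    Prime (b + n * M) ∧ Prime (b + (n + (m₁ - m₂)) * M))).card : ℝ) with hc
  rw [hK] at hsum
  constructor
  · intro hm
    have hW : ∏ p ∈ P, (1 + (pairDensity (m₁ - m₂) p : ℝ) / (p - pairDensity (m₁ - m₂) p)) =
        ∏ p ∈ P, (p : ℝ) / (p - 1) := Finset.prod_congr rfl fun p hp =>
      one_add_pairDensity_of_dvd (by linarith [hPz p hp]) (by simp [hm])
    rw [hW] at hcount
    have h1 : 4 * N' / (∏ p ∈ P, (p : ℝ) / (p - 1)) ≤ 4 * N' / (t / A) := by gcongr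
    have h2 : (N' : ℝ) / t ^ 2 ≤ N' / t := by
      gcongr
      exact le_self_pow₀ ht1 (by norm_num)
    have h3 : c ≤ (4 * A ^ 2 + 1) * (N' / t) := by
      have h4 : 4 * N' / (t / A) = 4 * A * (N' / t) := by field_simp
      have h5 : 4 * A * (N' / t) ≤ 4 * A ^ 2 * (N' / t) := by
        gcongr
        exact le_self_pow₀ hA1 (by norm_num)
      linarith
    calc _ ≤ (t / N') ^ 2 * c := hsum
      _ ≤ (t / N') ^ 2 * ((4 * A ^ 2 + 1) * (N' / t)) := by gcongr
      _ = (4 * A ^ 2 + 1) * (t / N') := by field_simp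
      _ = _ := by rw [← hK, mul_div_assoc]
  · intro hm
    have hsq := sq_prod_le_prod_pairDensity hz4 hPp hPz (sub_ne_zero.2 hm)
    set Q := ∏ p ∈ (m₁ - m₂).natAbs.primeFactors.filter (fun p : ℕ => z < (p : ℝ)),
      (p : ℝ) / ((p : ℝ) - 1) with hQ
    set W := ∏ p ∈ P, (1 + (pairDensity (m₁ - m₂) p : ℝ) / (p - pairDensity (m₁ - m₂) p))
    have hQ1 : 1 ≤ Q := by
      refine Finset.prod_induction _ (fun x : ℝ => 1 ≤ x) (fun _ _ => one_le_mul_of_one_le_of_one_le)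
        le_rfl fun p hp => ?_
      have := (Finset.mem_filter.1 hp).2
      rw [le_div_iff₀ (by linarith)]
      linarith
    have hWQ : t ^ 2 / A ^ 2 ≤ W * Q := by
      refine le_trans ?_ hsq
      rw [← div_pow]
      gcongr
    have hW0 : 0 < W := pos_of_mul_pos_left ((by positivity : 0 < t ^ 2 / A ^ 2).trans_le hWQ)
      (by linarith)
    have h1 : 4 * N' / W ≤ 4 * A ^ 2 * (N' / t ^ 2 * Q) := by
      rw [div_le_iff₀ hW0]
      calc 4 * (N' : ℝ) = 4 * A ^ 2 * (N' / t ^ 2) * (t ^ 2 / A ^ 2) := by field_simp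
        _ ≤ 4 * A ^ 2 * (N' / t ^ 2) * (W * Q) := by gcongr
        _ = _ := by ring
    have h2 : (N' : ℝ) / t ^ 2 ≤ N' / t ^ 2 * Q := le_mul_of_one_le_right (by positivity) hQ1
    have h3 : c ≤ (4 * A ^ 2 + 1) * (N' / t ^ 2 * Q) := by linarith
    calc _ ≤ (t / N') ^ 2 * c := hsum
      _ ≤ (t / N') ^ 2 * ((4 * A ^ 2 + 1) * (N' / t ^ 2 * Q)) := by gcongr
      _ = _ := by field_simp
end

section
/- Let S be a finite set with N' elements, let a: S → ℝ≥0, let 0 < α < 1 and c > 0, and assume ∑_{n ∈ S} a(n) ≥ α and ∑_{n ∈ S} a(n)² ≤ c/N'. Then the set A' = {n ∈ S : a(n) ≥ α/(2N')} satisfies |A'| ≥ α²N'/(4c). -/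
open scoped Classical

/-- **Extracting a dense set (Lemma 2 of §2.4).**
If `S` has `N'` elements, `a : S → ℝ≥0` satisfies `∑ a ≥ α` and `∑ a² ≤ c/N'`,
then `A' = {n ∈ S : a(n) ≥ α/(2N')}` has at least `α²N'/(4c)` elements. -/
theorem dense_subset_extraction {ι : Type*} (S : Finset ι) (N' : ℕ)
    (hcard : S.card = N') (a : ι → ℝ) (ha : ∀ n ∈ S, 0 ≤ a n)
    (α c : ℝ) (hα0 : 0 < α) (hα1 : α < 1) (hc : 0 < c)
    (h1 : ∑ n ∈ S, a n ≥ α)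
    (h2 : ∑ n ∈ S, (a n) ^ 2 ≤ c / N') :
    ((S.filter fun n => α / (2 * N') ≤ a n).card : ℝ) ≥ α ^ 2 * N' / (4 * c) := by
  rcases Nat.eq_zero_or_pos N' with h0 | hpos
  · simp [h0]
  have hN : (0 : ℝ) < N' := by exact_mod_cast hpos
  set A := S.filter fun n => α / (2 * N') ≤ a n
  have hsplit : ∑ n ∈ A, a n + ∑ n ∈ S.filter (fun n => ¬ α / (2 * N') ≤ a n), a n
      = ∑ n ∈ S, a n := Finset.sum_filter_add_sum_filter_not S _ a
  have hsmall : ∑ n ∈ S.filter (fun n => ¬ α / (2 * N') ≤ a n), a n ≤ α / 2 := by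
    calc ∑ n ∈ S.filter (fun n => ¬ α / (2 * N') ≤ a n), a n
        ≤ (S.filter (fun n => ¬ α / (2 * N') ≤ a n)).card • (α / (2 * N')) :=
          Finset.sum_le_card_nsmul _ _ _ fun n hn =>
            (not_le.mp (Finset.mem_filter.mp hn).2).le
      _ ≤ N' • (α / (2 * N')) := by
          gcongr
          exact hcard ▸ Finset.card_filter_le _ _
      _ = α / 2 := by
          rw [nsmul_eq_mul]
          field_simp
  have hlarge : α / 2 ≤ ∑ n ∈ A, a n := by linarith
  have hsq : ∑ n ∈ A, (a n) ^ 2 ≤ c / N' :=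
    (Finset.sum_le_sum_of_subset_of_nonneg (Finset.filter_subset _ _)
      fun n _ _ => sq_nonneg (a n)).trans h2
  have hbound : (α / 2) ^ 2 ≤ A.card * (c / N') :=
    calc (α / 2) ^ 2 ≤ (∑ n ∈ A, a n) ^ 2 := by gcongr
      _ ≤ A.card * ∑ n ∈ A, (a n) ^ 2 := sq_sum_le_card_mul_sum_sq
      _ ≤ A.card * (c / N') := by gcongr
  rw [← mul_div_assoc, le_div_iff₀ hN] at hbound
  rw [ge_iff_le, div_le_iff₀ (by positivity)]
  linarith
end
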